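/- arXiv:1704.08474 — 2 statements merged into one kernel-verified Lean document; each statement's English description precedes it below -/
import Mathlib

section
/- Let p ≥ 3 be an integer and let n = 4p + 2. Then the Graovac–Pisanski index of AT(n,p) satisfies Ŵ(AT(n,p)) = (p+1)·(n³p + (3n³)/4 + 2n²p + n² + (4np³)/3 − (4np)/3 − n). -/
open SimpleGraph

/-- Base relation for the armchair nanotube `AT(n,p)`: vertices are pairs `(i, j)` with
layer `i ∈ {0, …, p}` and position `j ∈ ℤ/2nℤ`.  `(i,j)` is related to `(i, j+1)`,
and to `(i+1, j-1)` when `j ≡ 2 (mod 4)`, and to `(i+1, j+1)` when `j ≡ 3 (mod 4)`. -/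
def ATRel (n p : ℕ) (u v : Fin (p + 1) × ZMod (2 * n)) : Prop :=
  (u.1 = v.1 ∧ v.2 = u.2 + 1) ∨
    ((u.1 : ℕ) + 1 = (v.1 : ℕ) ∧
      ((u.2.val % 4 = 2 ∧ v.2 = u.2 - 1) ∨ (u.2.val % 4 = 3 ∧ v.2 = u.2 + 1)))

/-- The armchair nanotube `AT(n,p)` as a simple graph. -/
def AT (n p : ℕ) : SimpleGraph (Fin (p + 1) × ZMod (2 * n)) :=
  SimpleGraph.fromRel (ATRel n p)

/-- `Vset n p k i` is the set `V^k_i` of vertices of type `k` in layer `i` of `AT(n,p)`: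
type `0` means `j mod 4 ∈ {0,1}`, type `1` means `j mod 4 ∈ {2,3}`. -/
def Vset (n p : ℕ) (k i : ℕ) : Set (Fin (p + 1) × ZMod (2 * n)) :=
  {v | (v.1 : ℕ) = i ∧ v.2.val % 4 / 2 = k}

/-- The set of vertices of `AT(n,p)` in layer `i` (the vertex set of the induced
cycle `C1` for `i = 0`, and of `C2` for `i = p`). -/
def layer (n p : ℕ) (i : ℕ) : Set (Fin (p + 1) × ZMod (2 * n)) :=
  {v | (v.1 : ℕ) = i}

/-- The Graovac–Pisanski index of a graph `G`:
`Ŵ(G) = (|V(G)| / (2 |Aut(G)|)) * Σ_u Σ_α d(u, α(u))`. -/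
noncomputable def GPindex {V : Type*} (G : SimpleGraph V) : ℚ :=
  ((Nat.card V : ℚ) / (2 * (Nat.card (G ≃g G) : ℚ))) *
    ∑ᶠ u : V, ∑ᶠ α : G ≃g G, (G.dist u (α u) : ℚ)


namespace ATProof

/-- Planar (universal cover) hexagonal distance between `(i,x)` and `(k,y)`. -/
def g (i x k y : ℤ) : ℕ :=
  ((y + 1) / 2 - (x + 1) / 2).natAbs + ((y / 4 - k) - (x / 4 - i)).natAbs +
    (((y + 2) / 4 + k) - ((x + 2) / 4 + i)).natAbs

lemma g_zero {i x k y : ℤ} (h : g i x k y = 0) : i = k ∧ x = y := by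
  unfold g at h
  omega

/-- One step relation upstairs. -/
def Step (i x k y : ℤ) : Prop :=
  (k = i ∧ y = x + 1) ∨ (k = i ∧ y = x - 1) ∨ (x % 4 = 2 ∧ k = i + 1 ∧ y = x - 1) ∨
  (x % 4 = 3 ∧ k = i + 1 ∧ y = x + 1) ∨ (x % 4 = 1 ∧ k + 1 = i ∧ y = x + 1) ∨
  (x % 4 = 0 ∧ k + 1 = i ∧ y = x - 1)

lemma g_step {i x i1 x1 : ℤ} (h : Step i x i1 x1) (k y : ℤ) :
    g i x k y ≤ g i1 x1 k y + 1 := by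
  have key : ((x1 + 1) / 2 - (x + 1) / 2).natAbs + ((x1 / 4 - i1) - (x / 4 - i)).natAbs +
    (((x1 + 2) / 4 + i1) - ((x + 2) / 4 + i)).natAbs ≤ 1 := by
    rcases h with h | h | h | h | h | h <;> omega
  unfold g
  generalize (x1 + 1) / 2 = a1 at *
  generalize (x + 1) / 2 = a at *
  generalize (y + 1) / 2 = a2 at *
  generalize (x1 / 4 - i1) = b1 at *
  generalize (x / 4 - i) = b at *
  generalize (y / 4 - k) = b2 at *
  generalize ((x1 + 2) / 4 + i1) = c1 at *
  generalize ((x + 2) / 4 + i) = c at *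
  generalize ((y + 2) / 4 + k) = c2 at *
  omega

lemma g_form {i x k y a b c : ℤ} (ha : (x + 1) / 2 = a) (hb : x / 4 - i = b)
    (hc : (x + 2) / 4 + i = c) :
    g i x k y = ((y + 1) / 2 - a).natAbs + ((y / 4 - k) - b).natAbs +
      (((y + 2) / 4 + k) - c).natAbs := by
  unfold g
  rw [ha, hb, hc]

lemma g_desc_up {q i k y : ℤ} (r : ℤ) (hr : r = 0 ∨ r = 1 ∨ r = 2 ∨ r = 3) (hik : i < k) :
    g i (4*q+r+1) k y + 1 = g i (4*q+r) k y ∨ g i (4*q+r-1) k y + 1 = g i (4*q+r) k y ∨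
    (r = 2 ∧ g (i+1) (4*q+r-1) k y + 1 = g i (4*q+r) k y) ∨
    (r = 3 ∧ g (i+1) (4*q+r+1) k y + 1 = g i (4*q+r) k y) := by
  rcases hr with rfl | rfl | rfl | rfl
  · by_cases h : 4*q+0 < y
    · left
      rw [g_form (a := 2*q+1) (b := q - (i + 0)) (c := q + (i + 0)) (by omega) (by omega) (by omega),
        g_form (a := 2*q) (b := q - i) (c := q + i) (by omega) (by omega) (by omega)]
      omega
    · right; left
      rw [g_form (a := 2*q) (b := q-1 - (i + 0)) (c := q + (i + 0)) (by omega) (by omega) (by omega),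
        g_form (a := 2*q) (b := q - i) (c := q + i) (by omega) (by omega) (by omega)]
      omega
  · by_cases h : y < 4*q+1
    · right; left
      rw [g_form (a := 2*q) (b := q - (i + 0)) (c := q + (i + 0)) (by omega) (by omega) (by omega),
        g_form (a := 2*q+1) (b := q - i) (c := q + i) (by omega) (by omega) (by omega)]
      omega
    · left
      rw [g_form (a := 2*q+1) (b := q - (i + 0)) (c := q+1 + (i + 0)) (by omega) (by omega) (by omega),
        g_form (a := 2*q+1) (b := q - i) (c := q + i) (by omega) (by omega) (by omega)]
      omega
  · by_cases h : 4*q+2 < y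
    · left
      rw [g_form (a := 2*q+2) (b := q - (i + 0)) (c := q+1 + (i + 0)) (by omega) (by omega) (by omega),
        g_form (a := 2*q+1) (b := q - i) (c := q+1 + i) (by omega) (by omega) (by omega)]
      omega
    · right; right; left; refine ⟨rfl, ?_⟩
      rw [g_form (a := 2*q+1) (b := q - (i + 1)) (c := q + (i + 1)) (by omega) (by omega) (by omega),
        g_form (a := 2*q+1) (b := q - i) (c := q+1 + i) (by omega) (by omega) (by omega)]
      omega
  · by_cases h : y < 4*q+3
    · right; left
      rw [g_form (a := 2*q+1) (b := q - (i + 0)) (c := q+1 + (i + 0)) (by omega) (by omega) (by omega),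
        g_form (a := 2*q+2) (b := q - i) (c := q+1 + i) (by omega) (by omega) (by omega)]
      omega
    · right; right; right; refine ⟨rfl, ?_⟩
      rw [g_form (a := 2*q+2) (b := q+1 - (i + 1)) (c := q+1 + (i + 1)) (by omega) (by omega) (by omega),
        g_form (a := 2*q+2) (b := q - i) (c := q+1 + i) (by omega) (by omega) (by omega)]
      omega

lemma g_desc_down {q i k y : ℤ} (r : ℤ) (hr : r = 0 ∨ r = 1 ∨ r = 2 ∨ r = 3) (hik : k < i) :
    g i (4*q+r+1) k y + 1 = g i (4*q+r) k y ∨ g i (4*q+r-1) k y + 1 = g i (4*q+r) k y ∨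
    (r = 1 ∧ g (i-1) (4*q+r+1) k y + 1 = g i (4*q+r) k y) ∨
    (r = 0 ∧ g (i-1) (4*q+r-1) k y + 1 = g i (4*q+r) k y) := by
  rcases hr with rfl | rfl | rfl | rfl
  · by_cases h : 4*q+0 < y
    · left
      rw [g_form (a := 2*q+1) (b := q - (i + 0)) (c := q + (i + 0)) (by omega) (by omega) (by omega),
        g_form (a := 2*q) (b := q - i) (c := q + i) (by omega) (by omega) (by omega)]
      omega
    · right; right; right; refine ⟨rfl, ?_⟩
      rw [g_form (a := 2*q) (b := q-1 - (i + -1)) (c := q + (i + -1)) (by omega) (by omega) (by omega),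
        g_form (a := 2*q) (b := q - i) (c := q + i) (by omega) (by omega) (by omega)]
      omega
  · by_cases h : y < 4*q+1
    · right; left
      rw [g_form (a := 2*q) (b := q - (i + 0)) (c := q + (i + 0)) (by omega) (by omega) (by omega),
        g_form (a := 2*q+1) (b := q - i) (c := q + i) (by omega) (by omega) (by omega)]
      omega
    · right; right; left; refine ⟨rfl, ?_⟩
      rw [g_form (a := 2*q+1) (b := q - (i + -1)) (c := q+1 + (i + -1)) (by omega) (by omega) (by omega),
        g_form (a := 2*q+1) (b := q - i) (c := q + i) (by omega) (by omega) (by omega)]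
      omega
  · by_cases h : 4*q+2 < y
    · left
      rw [g_form (a := 2*q+2) (b := q - (i + 0)) (c := q+1 + (i + 0)) (by omega) (by omega) (by omega),
        g_form (a := 2*q+1) (b := q - i) (c := q+1 + i) (by omega) (by omega) (by omega)]
      omega
    · right; left
      rw [g_form (a := 2*q+1) (b := q - (i + 0)) (c := q + (i + 0)) (by omega) (by omega) (by omega),
        g_form (a := 2*q+1) (b := q - i) (c := q+1 + i) (by omega) (by omega) (by omega)]
      omega
  · by_cases h : y < 4*q+3
    · right; left
      rw [g_form (a := 2*q+1) (b := q - (i + 0)) (c := q+1 + (i + 0)) (by omega) (by omega) (by omega),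
        g_form (a := 2*q+2) (b := q - i) (c := q+1 + i) (by omega) (by omega) (by omega)]
      omega
    · left
      rw [g_form (a := 2*q+2) (b := q+1 - (i + 0)) (c := q+1 + (i + 0)) (by omega) (by omega) (by omega),
        g_form (a := 2*q+2) (b := q - i) (c := q+1 + i) (by omega) (by omega) (by omega)]
      omega

lemma g_desc_eq {i x y : ℤ} (h : x ≠ y) :
    g i (x+1) i y + 1 = g i x i y ∨ g i (x-1) i y + 1 = g i x i y := by
  unfold g
  rcases lt_or_gt_of_ne h with h | h
  · left; omega
  · right; omega

lemma g_desc {i x k y : ℤ} (h : g i x k y ≠ 0) :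
    ∃ i1 x1, Step i x i1 x1 ∧ g i1 x1 k y + 1 = g i x k y ∧
      (i1 = i ∨ (i < k ∧ i1 = i + 1) ∨ (k < i ∧ i1 = i - 1)) := by
  have hx : x = 4 * (x / 4) + x % 4 := by omega
  have hr : x % 4 = 0 ∨ x % 4 = 1 ∨ x % 4 = 2 ∨ x % 4 = 3 := by omega
  rcases lt_trichotomy i k with hik | hik | hik
  · have := g_desc_up (q := x/4) (y := y) (x%4) hr hik
    rw [← hx] at this
    rcases this with h | h | ⟨h', h⟩ | ⟨h', h⟩
    · exact ⟨_, _, by unfold Step; omega, h, by omega⟩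
    · exact ⟨_, _, by unfold Step; omega, h, by omega⟩
    · exact ⟨_, _, by unfold Step; omega, h, by omega⟩
    · exact ⟨_, _, by unfold Step; omega, h, by omega⟩
  · subst hik
    have : x ≠ y := by
      rintro rfl
      apply h; unfold g; omega
    rcases g_desc_eq (i := i) this with h | h
    · exact ⟨_, _, by unfold Step; omega, h, by omega⟩
    · exact ⟨_, _, by unfold Step; omega, h, by omega⟩
  · have := g_desc_down (q := x/4) (y := y) (x%4) hr hik
    rw [← hx] at this
    rcases this with h | h | ⟨h', h⟩ | ⟨h', h⟩
    · exact ⟨_, _, by unfold Step; omega, h, by omega⟩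
    · exact ⟨_, _, by unfold Step; omega, h, by omega⟩
    · exact ⟨_, _, by unfold Step; omega, h, by omega⟩
    · exact ⟨_, _, by unfold Step; omega, h, by omega⟩

/-- shifting by a full turn does not help -/
lemma g_shift {p i k y s : ℤ} (hi : 0 ≤ i) (hip : i ≤ p) (hk : 0 ≤ k) (hkp : k ≤ p)
    (hy : -(4*p+1) ≤ y) (hy2 : y ≤ 4 * p + 2) (hs : s = 0 ∨ 2 * p + 1 ≤ s ∨ s ≤ -(2 * p + 1)) :
    g i 0 k y ≤ g i 0 k (y + 4 * s) := by
  unfold g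
  have h1 : (y + 4 * s + 1) / 2 = (y + 1) / 2 + 2 * s := by omega
  have h2 : (y + 4 * s) / 4 = y / 4 + s := by omega
  have h3 : (y + 4 * s + 2) / 4 = (y + 2) / 4 + s := by omega
  rw [h1, h2, h3]
  rcases hs with rfl | hs | hs
  · simp
  · omega
  · omega

end ATProof

namespace ATProof

instance (p : ℕ) : NeZero (2 * (4 * p + 2)) := ⟨by omega⟩

/-- the modulus-specific abbreviations -/
abbrev Z (p : ℕ) := ZMod (2 * (4 * p + 2))

/-- The graph under consideration. -/
abbrev G (p : ℕ) : SimpleGraph (Fin (p + 1) × Z p) := AT (4 * p + 2) p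

lemma val_mod (p : ℕ) (x : ℤ) : (((x : Z p).val : ℕ) : ℤ) % 4 = x % 4 := by
  rw [ZMod.val_intCast]
  apply Int.emod_emod_of_dvd
  exact ⟨2 * p + 1, by push_cast; ring⟩

lemma cast_eq {p : ℕ} {x y : ℤ} (h : (x : Z p) = (y : Z p)) :
    ∃ s : ℤ, y = x + 4 * s ∧ (s = 0 ∨ 2 * (p : ℤ) + 1 ≤ s ∨ s ≤ -(2 * p + 1)) := by
  rw [ZMod.intCast_eq_intCast_iff_dvd_sub] at h
  obtain ⟨c, hc⟩ := h
  refine ⟨(2 * p + 1) * c, by push_cast at hc; linarith, ?_⟩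
  rcases lt_trichotomy c 0 with h | h | h
  · right; right; nlinarith
  · left; simp [h]
  · right; left; nlinarith

lemma cast_mod {p : ℕ} {x y : ℤ} (h : (x : Z p) = (y : Z p)) : x % 4 = y % 4 := by
  obtain ⟨s, hs, -⟩ := cast_eq h
  omega

lemma adj_iff {p : ℕ} {i : Fin (p + 1)} {x : ℤ} {w : Fin (p + 1) × Z p} :
    (G p).Adj (i, (x : Z p)) w ↔ ∃ y : ℤ, w.2 = (y : Z p) ∧ Step i x w.1 y := by
  obtain ⟨k, w⟩ := w
  obtain ⟨z, rfl⟩ := ZMod.intCast_surjective w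
  have hx := val_mod p x
  have hz := val_mod p z
  simp only [G, AT, fromRel_adj, ATRel]
  constructor
  · rintro ⟨-, (⟨h1, h2⟩ | ⟨h1, ⟨h2, h3⟩ | ⟨h2, h3⟩⟩) | (⟨h1, h2⟩ | ⟨h1, ⟨h2, h3⟩ | ⟨h2, h3⟩⟩)⟩
    · exact ⟨x + 1, by rw [h2]; push_cast; rfl, by subst h1; unfold Step; omega⟩
    · exact ⟨x - 1, by rw [h3]; push_cast; rfl, by unfold Step; omega⟩
    · exact ⟨x + 1, by rw [h3]; push_cast; rfl, by unfold Step; omega⟩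
    · exact ⟨x - 1, by push_cast; rw [h2]; ring, by subst h1; unfold Step; omega⟩
    · have : ((x : ℤ) : Z p) = ((z - 1 : ℤ) : Z p) := by rw [h3]; push_cast; rfl
      have := cast_mod this
      exact ⟨x + 1, by push_cast; rw [h3]; ring, by unfold Step; omega⟩
    · have : ((x : ℤ) : Z p) = ((z + 1 : ℤ) : Z p) := by rw [h3]; push_cast; rfl
      have := cast_mod this
      exact ⟨x - 1, by push_cast; rw [h3]; ring, by unfold Step; omega⟩
  · rintro ⟨y, h, hs⟩
    have hm := cast_mod h
    refine ⟨?_, ?_⟩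
    · intro e
      have e2 := congrArg Prod.snd e
      simp only at e2
      have := cast_mod e2
      unfold Step at hs
      omega
    · unfold Step at hs
      rcases hs with ⟨h1, h2⟩ | ⟨h1, h2⟩ | ⟨h1, h2, h3⟩ | ⟨h1, h2, h3⟩ | ⟨h1, h2, h3⟩ | ⟨h1, h2, h3⟩
      · left; left
        exact ⟨by ext; omega, by rw [h, h2]; push_cast; rfl⟩
      · right; left
        exact ⟨by ext; omega, by rw [h, h2]; push_cast; ring⟩
      · left; right
        exact ⟨by omega, Or.inl ⟨by omega, by rw [h, h3]; push_cast; rfl⟩⟩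
      · left; right
        exact ⟨by omega, Or.inr ⟨by omega, by rw [h, h3]; push_cast; rfl⟩⟩
      · right; right
        exact ⟨by omega, Or.inl ⟨by omega, by rw [h, h3]; push_cast; ring⟩⟩
      · right; right
        exact ⟨by omega, Or.inr ⟨by omega, by rw [h, h3]; push_cast; ring⟩⟩

lemma adj_of {p : ℕ} {i k : Fin (p + 1)} {x y : ℤ} (h : Step i x k y) :
    (G p).Adj (i, (x : Z p)) (k, (y : Z p)) := adj_iff.2 ⟨y, rfl, h⟩

lemma lift_walk {p : ℕ} {u v : Fin (p + 1) × Z p} (w : (G p).Walk u v) :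
    ∀ x : ℤ, u.2 = (x : Z p) → ∃ y : ℤ, v.2 = (y : Z p) ∧ g u.1 x v.1 y ≤ w.length := by
  induction w with
  | nil => intro x hx; exact ⟨x, hx, by simp [g]⟩
  | @cons u u1 v hadj w ih =>
    intro x hx
    have : u = (u.1, (x : Z p)) := by rw [← hx]
    rw [this] at hadj
    obtain ⟨x1, h1, hs⟩ := adj_iff.1 hadj
    obtain ⟨y, hy, hg⟩ := ih x1 h1
    refine ⟨y, hy, ?_⟩
    have := g_step hs v.1 y
    rw [Walk.length_cons]
    omega

lemma exists_walk {p : ℕ} (k : Fin (p + 1)) (y : ℤ) (m : ℕ) : ∀ (i : Fin (p + 1)) (x : ℤ),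
    g i x k y = m → ∃ w : (G p).Walk (i, (x : Z p)) (k, (y : Z p)), w.length = m := by
  induction m with
  | zero =>
    intro i x h
    obtain ⟨h1, h2⟩ := g_zero h
    have h1 : i = k := by ext; omega
    subst h1 h2
    exact ⟨Walk.nil, rfl⟩
  | succ m ih =>
    intro i x h
    obtain ⟨i1, x1, hs, hg, hb⟩ := g_desc (i := i) (x := x) (k := k) (y := y) (by omega)
    have hi := i.2
    have hk := k.2
    obtain ⟨j, rfl⟩ : ∃ j : Fin (p + 1), i1 = ((j : ℕ) : ℤ) :=
      ⟨⟨i1.toNat, by omega⟩, by simp only; omega⟩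
    obtain ⟨w, hw⟩ := ih j x1 (by omega)
    exact ⟨Walk.cons (adj_of hs) w, by simp [hw]⟩

lemma dist_eq {p : ℕ} (i k : Fin (p + 1)) (y : ℤ) (hy : -(4 * (p : ℤ) + 1) ≤ y)
    (hy2 : y ≤ 4 * (p : ℤ) + 2) :
    (G p).dist (i, 0) (k, (y : Z p)) = g i 0 k y := by
  have h0 := exists_walk k y _ i 0 rfl
  rw [Int.cast_zero] at h0
  obtain ⟨w, hw⟩ := h0
  apply le_antisymm
  · rw [← hw]; exact dist_le w
  · obtain ⟨w', hw'⟩ := (Reachable.exists_walk_length_eq_dist ⟨w⟩ : _)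
    obtain ⟨z, hz, hg⟩ := lift_walk w' 0 (by simp)
    obtain ⟨s, rfl, hs⟩ := cast_eq hz
    have hi := i.2
    have hk := k.2
    have := g_shift (p := p) (i := i) (k := k) (y := y) (s := s) (by omega) (by omega) (by omega)
      (by omega) hy hy2 hs
    simp only at hg
    omega

end ATProof

namespace ATProof

/-- An isomorphism from two mutually inverse homomorphisms. -/
def mkIso {V : Type*} (H : SimpleGraph V) (F F' : V → V) (h1 : ∀ u, F' (F u) = u)
    (h2 : ∀ u, F (F' u) = u) (a : ∀ u v, H.Adj u v → H.Adj (F u) (F v))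
    (a' : ∀ u v, H.Adj u v → H.Adj (F' u) (F' v)) : H ≃g H where
  toFun := F
  invFun := F'
  left_inv := h1
  right_inv := h2
  map_rel_iff' := by
    intro u v
    constructor
    · intro h
      have := a' _ _ h
      simpa [h1] using this
    · exact a u v

lemma step_rot {i x k y q : ℤ} (h : Step i x k y) : Step i (x + 4 * q) k (y + 4 * q) := by
  rcases h with h | h | h | h | h | h
  · exact Or.inl (by omega)
  · exact Or.inr (Or.inl (by omega))
  · exact Or.inr (Or.inr (Or.inl (by omega)))
  · exact Or.inr (Or.inr (Or.inr (Or.inl (by omega))))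
  · exact Or.inr (Or.inr (Or.inr (Or.inr (Or.inl (by omega)))))
  · exact Or.inr (Or.inr (Or.inr (Or.inr (Or.inr (by omega)))))

lemma step_ref {i x k y : ℤ} (h : Step i x k y) : Step i (1 - x) k (1 - y) := by
  rcases h with h | h | h | h | h | h
  · exact Or.inr (Or.inl (by omega))
  · exact Or.inl (by omega)
  · exact Or.inr (Or.inr (Or.inr (Or.inl (by omega))))
  · exact Or.inr (Or.inr (Or.inl (by omega)))
  · exact Or.inr (Or.inr (Or.inr (Or.inr (Or.inr (by omega)))))
  · exact Or.inr (Or.inr (Or.inr (Or.inr (Or.inl (by omega)))))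

lemma step_flip {i x k y p : ℤ} (h : Step i x k y) :
    Step (p - i) (-1 - x) (p - k) (-1 - y) := by
  rcases h with h | h | h | h | h | h
  · exact Or.inr (Or.inl (by omega))
  · exact Or.inl (by omega)
  · exact Or.inr (Or.inr (Or.inr (Or.inr (Or.inl (by omega)))))
  · exact Or.inr (Or.inr (Or.inr (Or.inr (Or.inr (by omega)))))
  · exact Or.inr (Or.inr (Or.inl (by omega)))
  · exact Or.inr (Or.inr (Or.inr (Or.inl (by omega))))

lemma rot_adj (p : ℕ) (q : ℤ) (u v : Fin (p + 1) × Z p) (h : (G p).Adj u v) :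
    (G p).Adj (u.1, u.2 + ((4 * q : ℤ) : Z p)) (v.1, v.2 + ((4 * q : ℤ) : Z p)) := by
  obtain ⟨i, u⟩ := u
  obtain ⟨x, rfl⟩ := ZMod.intCast_surjective u
  obtain ⟨y, hy, hs⟩ := adj_iff.1 h
  simp only [hy, ← Int.cast_add]
  exact adj_of (step_rot hs)

lemma ref_adj (p : ℕ) (u v : Fin (p + 1) × Z p) (h : (G p).Adj u v) :
    (G p).Adj (u.1, 1 - u.2) (v.1, 1 - v.2) := by
  obtain ⟨i, u⟩ := u
  obtain ⟨x, rfl⟩ := ZMod.intCast_surjective u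
  obtain ⟨y, hy, hs⟩ := adj_iff.1 h
  have := adj_of (p := p) (i := i) (k := v.1) (x := 1 - x) (y := 1 - y) (step_ref hs)
  simpa [hy] using this

lemma cast_rev {p : ℕ} (i : Fin (p + 1)) : (((Fin.rev i : Fin (p + 1)) : ℕ) : ℤ) = p - (i : ℕ) := by
  have := i.2
  rw [Fin.val_rev]
  omega

lemma flip_adj (p : ℕ) (u v : Fin (p + 1) × Z p) (h : (G p).Adj u v) :
    (G p).Adj (Fin.rev u.1, -1 - u.2) (Fin.rev v.1, -1 - v.2) := by
  obtain ⟨i, u⟩ := u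
  obtain ⟨x, rfl⟩ := ZMod.intCast_surjective u
  obtain ⟨y, hy, hs⟩ := adj_iff.1 h
  have := adj_of (p := p) (i := Fin.rev i) (k := Fin.rev v.1) (x := -1 - x) (y := -1 - y)
    (by rw [cast_rev, cast_rev]; exact step_flip hs)
  simpa [hy] using this

/-- rotation -/
def rot (p : ℕ) (q : ℤ) : G p ≃g G p :=
  mkIso (G p) (fun u => (u.1, u.2 + ((4 * q : ℤ) : Z p)))
    (fun u => (u.1, u.2 + ((4 * (-q) : ℤ) : Z p)))
    (by intro u; ext <;> simp) (by intro u; ext <;> simp)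
    (rot_adj p q) (rot_adj p (-q))

/-- reflection -/
def refl' (p : ℕ) : G p ≃g G p :=
  mkIso (G p) (fun u => (u.1, 1 - u.2)) (fun u => (u.1, 1 - u.2))
    (by intro u; ext <;> simp) (by intro u; ext <;> simp)
    (ref_adj p) (ref_adj p)

/-- flip -/
def flip' (p : ℕ) : G p ≃g G p :=
  mkIso (G p) (fun u => (Fin.rev u.1, -1 - u.2)) (fun u => (Fin.rev u.1, -1 - u.2))
    (by intro u; ext <;> simp) (by intro u; ext <;> simp)
    (flip_adj p) (flip_adj p)

/-- The list of automorphisms. -/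
def E (p : ℕ) (ts : Fin 4 × Fin (2 * p + 1)) : G p ≃g G p :=
  match ts.1 with
  | 0 => rot p ((ts.2 : ℤ) - p)
  | 1 => (refl' p).trans (rot p ((ts.2 : ℤ) - p))
  | 2 => (flip' p).trans (rot p ((ts.2 : ℤ) - p))
  | 3 => ((flip' p).trans (refl' p)).trans (rot p ((ts.2 : ℤ) - p))

lemma E0 (p : ℕ) (s : Fin (2 * p + 1)) (i : Fin (p + 1)) :
    E p (0, s) (i, 0) = (i, ((4 * ((s : ℤ) - p) : ℤ) : Z p)) := by
  simp [E, rot, refl', flip', mkIso]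

lemma E1 (p : ℕ) (s : Fin (2 * p + 1)) (i : Fin (p + 1)) :
    E p (1, s) (i, 0) = (i, ((4 * ((s : ℤ) - p) + 1 : ℤ) : Z p)) := by
  simp [E, rot, refl', flip', mkIso]
  ring

lemma E2 (p : ℕ) (s : Fin (2 * p + 1)) (i : Fin (p + 1)) :
    E p (2, s) (i, 0) = (Fin.rev i, ((4 * ((s : ℤ) - p) - 1 : ℤ) : Z p)) := by
  simp [E, rot, refl', flip', mkIso]
  ring

lemma E3 (p : ℕ) (s : Fin (2 * p + 1)) (i : Fin (p + 1)) :
    E p (3, s) (i, 0) = (Fin.rev i, ((4 * ((s : ℤ) - p) + 2 : ℤ) : Z p)) := by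
  simp [E, rot, refl', flip', mkIso]
  ring

lemma exists_rep (p : ℕ) (u : Z p) :
    ∃ x : ℤ, u = (x : Z p) ∧ -(4 * (p : ℤ) + 1) ≤ x ∧ x ≤ 4 * p + 2 := by
  have h := u.val_lt
  have hv : ((u.val : ℕ) : Z p) = u := ZMod.natCast_zmod_val u
  by_cases hc : (u.val : ℤ) ≤ 4 * p + 2
  · exact ⟨u.val, by simp, by omega, by omega⟩
  · refine ⟨(u.val : ℤ) - ((2 * (4 * p + 2) : ℕ) : ℤ), ?_, by omega, by omega⟩
    rw [Int.cast_sub, Int.cast_natCast, Int.cast_natCast, ZMod.natCast_self]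
    simp

lemma exists_E {p : ℕ} (v : Fin (p + 1) × Z p) : ∃ ts i, E p ts (i, 0) = v := by
  obtain ⟨k, u⟩ := v
  obtain ⟨x, rfl, h1, h2⟩ := exists_rep p u
  have hr : x % 4 = 0 ∨ x % 4 = 1 ∨ x % 4 = 2 ∨ x % 4 = 3 := by omega
  rcases hr with hr | hr | hr | hr
  · refine ⟨(0, ⟨(x / 4 + p).toNat, by omega⟩), k, ?_⟩
    rw [E0]; congr 2; simp only; omega
  · refine ⟨(1, ⟨(x / 4 + p).toNat, by omega⟩), k, ?_⟩
    rw [E1]; congr 2; simp only; omega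
  · refine ⟨(3, ⟨(x / 4 + p).toNat, by omega⟩), Fin.rev k, ?_⟩
    rw [E3, Fin.rev_rev]; congr 2; simp only; omega
  · refine ⟨(2, ⟨(x / 4 + 1 + p).toNat, by omega⟩), Fin.rev k, ?_⟩
    rw [E2, Fin.rev_rev]; congr 2; simp only; omega

lemma E_inj (p : ℕ) : Function.Injective (E p) := by
  rintro ⟨t, s⟩ ⟨t', s'⟩ h
  have h0 : (E p (t, s) (0, 0)).2 = (E p (t', s') (0, 0)).2 := by rw [h]
  have hs := s.2
  have hs' := s'.2
  have key : t = t' ∧ (s : ℕ) = s' := by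
    fin_cases t <;> fin_cases t' <;>
      simp only [Fin.zero_eta, Fin.mk_one, Fin.reduceFinMk, E0, E1, E2, E3] at h0 <;>
      obtain ⟨c, hc, hc'⟩ := cast_eq h0 <;>
      first
      | (exfalso; omega)
      | (refine ⟨rfl, ?_⟩; omega)
  obtain ⟨rfl, h2⟩ := key
  rw [Fin.ext h2]

/-- having at most two neighbours -/
def D2 {V : Type*} (H : SimpleGraph V) (v : V) : Prop := ∃ a b, ∀ w, H.Adj v w → w = a ∨ w = b

lemma D2_map {V : Type*} {H : SimpleGraph V} (α : H ≃g H) {v : V} (h : D2 H v) : D2 H (α v) := by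
  obtain ⟨a, b, h⟩ := h
  refine ⟨α a, α b, fun w hw => ?_⟩
  have : H.Adj v (α.symm w) := by
    rw [← α.map_adj_iff]; simpa using hw
  rcases h _ this with h | h
  · left; rw [← h]; simp
  · right; rw [← h]; simp

lemma D2_map_iff {V : Type*} {H : SimpleGraph V} (α : H ≃g H) {v : V} : D2 H (α v) ↔ D2 H v :=
  ⟨fun h => by simpa using D2_map α.symm h, D2_map α⟩

lemma D2_bot {p : ℕ} {x : ℤ} (hx : x % 4 = 0 ∨ x % 4 = 1) : D2 (G p) (0, (x : Z p)) := by
  refine ⟨(0, ((x + 1 : ℤ) : Z p)), (0, ((x - 1 : ℤ) : Z p)), ?_⟩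
  rintro ⟨k, w⟩ hw
  obtain ⟨y, rfl, hs⟩ := adj_iff.1 hw
  unfold Step at hs
  have h00 : ((0 : Fin (p + 1)) : ℕ) = 0 := rfl
  simp only [h00] at hs
  rcases hs with ⟨h1, rfl⟩ | ⟨h1, rfl⟩ | h | h | h | h
  · left; congr 1; apply Fin.ext; rw [h00]; omega
  · right; congr 1; apply Fin.ext; rw [h00]; omega
  all_goals omega

lemma not_D2 {p : ℕ} {i k : Fin (p + 1)} {x y : ℤ} (hk : i ≠ k) (hs : Step i x k y) :
    ¬ D2 (G p) (i, (x : Z p)) := by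
  rintro ⟨a, b, h⟩
  have h1 := h _ (adj_of (p := p) (i := i) (k := i) (x := x) (y := x + 1) (by unfold Step; omega))
  have h2 := h _ (adj_of (p := p) (i := i) (k := i) (x := x) (y := x - 1) (by unfold Step; omega))
  have h3 := h _ (adj_of hs)
  have n12 : ((i, ((x + 1 : ℤ) : Z p)) : Fin (p + 1) × Z p) ≠ (i, ((x - 1 : ℤ) : Z p)) := by
    intro e
    have := cast_mod (congrArg Prod.snd e)
    omega
  have n13 : ((i, ((x + 1 : ℤ) : Z p)) : Fin (p + 1) × Z p) ≠ (k, (y : Z p)) :=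
    fun e => hk (congrArg Prod.fst e)
  have n23 : ((i, ((x - 1 : ℤ) : Z p)) : Fin (p + 1) × Z p) ≠ (k, (y : Z p)) :=
    fun e => hk (congrArg Prod.fst e)
  grind

lemma not_D2_up {p : ℕ} {i : Fin (p + 1)} {x : ℤ} (hi : (i : ℕ) < p)
    (hx : x % 4 = 2 ∨ x % 4 = 3) : ¬ D2 (G p) (i, (x : Z p)) := by
  rcases hx with hx | hx
  · apply not_D2 (k := ⟨i + 1, by omega⟩) (y := x - 1) (by intro h; simp [Fin.ext_iff] at h)
    unfold Step; simp only [and_true]; omega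
  · apply not_D2 (k := ⟨i + 1, by omega⟩) (y := x + 1) (by intro h; simp [Fin.ext_iff] at h)
    unfold Step; simp only [and_true]; omega

lemma not_D2_down {p : ℕ} {i : Fin (p + 1)} {x : ℤ} (hi : 0 < (i : ℕ))
    (hx : x % 4 = 0 ∨ x % 4 = 1) : ¬ D2 (G p) (i, (x : Z p)) := by
  rcases hx with hx | hx
  · apply not_D2 (k := ⟨i - 1, by omega⟩) (y := x - 1)
      (by intro h; simp [Fin.ext_iff] at h; omega)
    unfold Step; simp only [and_true]; omega
  · apply not_D2 (k := ⟨i - 1, by omega⟩) (y := x + 1)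
      (by intro h; simp [Fin.ext_iff] at h; omega)
    unfold Step; simp only [and_true]; omega

end ATProof

namespace ATProof

lemma fix_of {p : ℕ} (α : G p ≃g G p) {i k : Fin (p + 1)} {x y : ℤ}
    (h0 : α (i, (x : Z p)) = (i, (x : Z p))) (hs : Step i x k y)
    (h : ∀ (k' : Fin (p + 1)) (y' : ℤ), Step i x k' y' →
      (k' = k ∧ y' = y) ∨ α (k', (y' : Z p)) = (k', (y' : Z p)) ∨
        α (k, (y : Z p)) ≠ (k', (y' : Z p))) :
    α (k, (y : Z p)) = (k, (y : Z p)) := by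
  have h1 : (G p).Adj (i, (x : Z p)) (α (k, (y : Z p))) := by
    rw [← h0, α.map_adj_iff]
    exact adj_of hs
  obtain ⟨y', hy', hs'⟩ := adj_iff.1 h1
  have e : α (k, (y : Z p)) = ((α (k, (y : Z p))).1, (y' : Z p)) := by rw [← hy']
  rcases h _ y' hs' with ⟨h2, h3⟩ | h2 | h2
  · rw [e, h2, h3]
  · rw [← e] at h2
    exact α.injective h2
  · exact absurd e h2

lemma fix_start {p : ℕ} (hp : 3 ≤ p) (α : G p ≃g G p) (h0 : α (0, ((0 : ℤ) : Z p)) = (0, ((0 : ℤ) : Z p))) :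
    α (0, ((1 : ℤ) : Z p)) = (0, ((1 : ℤ) : Z p)) := by
  have h00 : ((0 : Fin (p + 1)) : ℕ) = 0 := rfl
  refine fix_of α h0 (Or.inl (by omega)) ?_
  intro k' y' hs
  unfold Step at hs
  simp only [h00] at hs
  have hk : k' = 0 := by apply Fin.ext; rw [h00]; omega
  subst hk
  have hy : y' = 1 ∨ y' = -1 := by omega
  rcases hy with rfl | rfl
  · left; simp
  · right; right
    intro e
    have h2 := D2_map α (D2_bot (p := p) (x := 1) (by omega))
    rw [e] at h2
    exact not_D2_up (by omega) (by omega) h2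

lemma fix_next {p : ℕ} (hp : 3 ≤ p) (α : G p ≃g G p) (x : ℤ) (hx : x % 4 = 0)
    (h0 : α (0, (x : Z p)) = (0, (x : Z p)))
    (h1 : α (0, ((x + 1 : ℤ) : Z p)) = (0, ((x + 1 : ℤ) : Z p))) :
    α (0, ((x + 2 : ℤ) : Z p)) = (0, ((x + 2 : ℤ) : Z p)) ∧
    α (0, ((x + 3 : ℤ) : Z p)) = (0, ((x + 3 : ℤ) : Z p)) ∧
    α (0, ((x + 4 : ℤ) : Z p)) = (0, ((x + 4 : ℤ) : Z p)) ∧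
    α (0, ((x + 5 : ℤ) : Z p)) = (0, ((x + 5 : ℤ) : Z p)) := by
  have h00 : ((0 : Fin (p + 1)) : ℕ) = 0 := rfl
  have f2 : α (0, ((x + 2 : ℤ) : Z p)) = (0, ((x + 2 : ℤ) : Z p)) := by
    refine fix_of α h1 (Or.inl (by omega)) ?_
    intro k' y' hs
    unfold Step at hs
    simp only [h00] at hs
    have hk : k' = 0 := by apply Fin.ext; rw [h00]; omega
    subst hk
    have hy : y' = x + 2 ∨ y' = x := by omega
    rcases hy with rfl | rfl
    · left; simp
    · right; left; exact h0
  have f3 : α (0, ((x + 3 : ℤ) : Z p)) = (0, ((x + 3 : ℤ) : Z p)) := by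
    refine fix_of α f2 (Or.inl (by omega)) ?_
    intro k' y' hs
    unfold Step at hs
    simp only [h00] at hs
    have hy : ((k' : ℕ) = 0 ∧ y' = x + 3) ∨ ((k' : ℕ) = 0 ∧ y' = x + 1) ∨ ((k' : ℕ) = 1 ∧ y' = x + 1) := by
      omega
    rcases hy with ⟨hk, rfl⟩ | ⟨hk, rfl⟩ | ⟨hk, rfl⟩
    · left; exact ⟨Fin.ext hk, rfl⟩
    · have hk : k' = 0 := Fin.ext hk
      subst hk
      right; left; exact h1
    · right; right
      intro e
      have a4 : (G p).Adj (0, ((x + 3 : ℤ) : Z p)) (0, ((x + 4 : ℤ) : Z p)) :=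
        adj_of (Or.inl (by omega))
      rw [← α.map_adj_iff, e] at a4
      have d4 := D2_map α (D2_bot (p := p) (x := x + 4) (by omega))
      generalize α (0, ((x + 4 : ℤ) : Z p)) = w at a4 d4
      obtain ⟨z, hz, hs4⟩ := adj_iff.1 a4
      have hw : w = (w.1, (z : Z p)) := by rw [← hz]
      rw [hw] at d4
      unfold Step at hs4
      simp only [hk] at hs4
      have hc : ((w.1 : ℕ) = 1 ∧ z = x + 2) ∨ ((w.1 : ℕ) = 1 ∧ z = x) ∨ ((w.1 : ℕ) = 0 ∧ z = x + 2) := by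
        omega
      rcases hc with ⟨hc, rfl⟩ | ⟨hc, rfl⟩ | ⟨hc, rfl⟩
      · exact not_D2_up (by omega) (by omega) d4
      · exact not_D2_down (by omega) (by omega) d4
      · exact not_D2_up (by omega) (by omega) d4
  have f4 : α (0, ((x + 4 : ℤ) : Z p)) = (0, ((x + 4 : ℤ) : Z p)) := by
    refine fix_of α f3 (Or.inl (by omega)) ?_
    intro k' y' hs
    unfold Step at hs
    simp only [h00] at hs
    have hy : ((k' : ℕ) = 0 ∧ y' = x + 4) ∨ ((k' : ℕ) = 0 ∧ y' = x + 2) ∨ ((k' : ℕ) = 1 ∧ y' = x + 4) := by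
      omega
    rcases hy with ⟨hk, rfl⟩ | ⟨hk, rfl⟩ | ⟨hk, rfl⟩
    · left; exact ⟨Fin.ext hk, rfl⟩
    · have hk : k' = 0 := Fin.ext hk
      subst hk
      right; left; exact f2
    · right; right
      intro e
      have d4 := D2_map α (D2_bot (p := p) (x := x + 4) (by omega))
      rw [e] at d4
      exact not_D2_down (by omega) (by omega) d4
  refine ⟨f2, f3, f4, ?_⟩
  refine fix_of α f4 (Or.inl (by omega)) ?_
  intro k' y' hs
  unfold Step at hs
  simp only [h00] at hs
  have hk : k' = 0 := by apply Fin.ext; rw [h00]; omega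
  subst hk
  have hy : y' = x + 5 ∨ y' = x + 3 := by omega
  rcases hy with rfl | rfl
  · left; simp
  · right; left; exact f3

lemma fix_layer0 {p : ℕ} (hp : 3 ≤ p) (α : G p ≃g G p)
    (h0 : α (0, ((0 : ℤ) : Z p)) = (0, ((0 : ℤ) : Z p))) (u : Z p) : α (0, u) = (0, u) := by
  have key : ∀ m : ℕ, α (0, ((4 * m : ℤ) : Z p)) = (0, ((4 * m : ℤ) : Z p)) ∧
      α (0, ((4 * m + 1 : ℤ) : Z p)) = (0, ((4 * m + 1 : ℤ) : Z p)) := by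
    intro m
    induction m with
    | zero => exact ⟨by simpa using h0, by simpa using fix_start hp α h0⟩
    | succ m ih =>
      obtain ⟨-, -, a, b⟩ := fix_next hp α (4 * m) (by omega) ih.1 ih.2
      have e1 : (4 * ((m + 1 : ℕ) : ℤ)) = 4 * m + 4 := by push_cast; ring
      have e2 : (4 * (m : ℤ) + 4 + 1) = 4 * m + 5 := by ring
      rw [e1, e2]
      exact ⟨a, b⟩
  have hu : u = ((u.val : ℤ) : Z p) := by simp
  obtain ⟨a, b⟩ := key (u.val / 4)
  obtain ⟨c, d, -, -⟩ := fix_next hp α (4 * ((u.val / 4 : ℕ) : ℤ)) (by omega) a b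
  have hr : (u.val : ℤ) = 4 * ((u.val / 4 : ℕ) : ℤ) ∨ (u.val : ℤ) = 4 * ((u.val / 4 : ℕ) : ℤ) + 1 ∨
    (u.val : ℤ) = 4 * ((u.val / 4 : ℕ) : ℤ) + 2 ∨ (u.val : ℤ) = 4 * ((u.val / 4 : ℕ) : ℤ) + 3 := by
    omega
  rw [hu]
  rcases hr with hr | hr | hr | hr <;> rw [hr] <;> assumption

lemma fix_up {p : ℕ} (α : G p ≃g G p) (i k : Fin (p + 1)) (hik : (k : ℕ) = i + 1)
    (h : ∀ x : ℤ, α (i, (x : Z p)) = (i, (x : Z p))) (x : ℤ) :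
    α (k, (x : Z p)) = (k, (x : Z p)) := by
  have low : ∀ x : ℤ, x % 4 = 0 ∨ x % 4 = 1 → α (k, (x : Z p)) = (k, (x : Z p)) := by
    intro x hx
    rcases hx with hx | hx
    · refine fix_of α (h (x - 1)) (Or.inr (Or.inr (Or.inr (Or.inl (by omega))))) ?_
      intro k' y' hs
      unfold Step at hs
      have : ((k' : ℕ) = k ∧ y' = x) ∨ (k' : ℕ) = i := by omega
      rcases this with ⟨hk, hy⟩ | hk
      · left; exact ⟨Fin.ext hk, hy⟩
      · right; left
        have hk : k' = i := Fin.ext hk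
        rw [hk]; exact h y'
    · refine fix_of α (h (x + 1)) (Or.inr (Or.inr (Or.inl (by omega)))) ?_
      intro k' y' hs
      unfold Step at hs
      have : ((k' : ℕ) = k ∧ y' = x) ∨ (k' : ℕ) = i := by omega
      rcases this with ⟨hk, hy⟩ | hk
      · left; exact ⟨Fin.ext hk, hy⟩
      · right; left
        have hk : k' = i := Fin.ext hk
        rw [hk]; exact h y'
  have hr : x % 4 = 0 ∨ x % 4 = 1 ∨ x % 4 = 2 ∨ x % 4 = 3 := by omega
  rcases hr with hr | hr | hr | hr
  · exact low x (by omega)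
  · exact low x (by omega)
  · refine fix_of α (low (x - 1) (by omega)) (Or.inl (by omega)) ?_
    intro k' y' hs
    unfold Step at hs
    have : ((k' : ℕ) = k ∧ y' = x) ∨ (k' : ℕ) = i ∨ ((k' : ℕ) = k ∧ y' = x - 2) := by omega
    rcases this with ⟨hk, hy⟩ | hk | ⟨hk, rfl⟩
    · left; exact ⟨Fin.ext hk, hy⟩
    · right; left
      have hk : k' = i := Fin.ext hk
      rw [hk]; exact h y'
    · right; left
      have hk : k' = k := Fin.ext hk
      rw [hk]; exact low _ (by omega)
  · refine fix_of α (low (x + 1) (by omega)) (Or.inr (Or.inl (by omega))) ?_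
    intro k' y' hs
    unfold Step at hs
    have : ((k' : ℕ) = k ∧ y' = x) ∨ (k' : ℕ) = i ∨ ((k' : ℕ) = k ∧ y' = x + 2) := by omega
    rcases this with ⟨hk, hy⟩ | hk | ⟨hk, rfl⟩
    · left; exact ⟨Fin.ext hk, hy⟩
    · right; left
      have hk : k' = i := Fin.ext hk
      rw [hk]; exact h y'
    · right; left
      have hk : k' = k := Fin.ext hk
      rw [hk]; exact low _ (by omega)

lemma rigid {p : ℕ} (hp : 3 ≤ p) (α : G p ≃g G p)
    (h0 : α (0, (0 : Z p)) = (0, (0 : Z p))) (v : Fin (p + 1) × Z p) : α v = v := by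
  have key : ∀ m : ℕ, ∀ hm : m < p + 1, ∀ x : ℤ, α (⟨m, hm⟩, (x : Z p)) = (⟨m, hm⟩, (x : Z p)) := by
    intro m
    induction m with
    | zero =>
      intro hm x
      exact fix_layer0 hp α (by simpa using h0) x
    | succ m ih =>
      intro hm x
      exact fix_up α ⟨m, by omega⟩ ⟨m + 1, hm⟩ rfl (ih (by omega)) x
  obtain ⟨i, u⟩ := v
  obtain ⟨x, rfl⟩ := ZMod.intCast_surjective u
  exact key i i.2 x

lemma E_surj {p : ℕ} (hp : 3 ≤ p) : Function.Surjective (E p) := by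
  intro α
  obtain ⟨ts, i, h⟩ := exists_E (α (0, 0))
  refine ⟨ts, ?_⟩
  have d : D2 (G p) (α (0, 0)) := D2_map α (by simpa using D2_bot (p := p) (x := 0) (by omega))
  rw [← h, D2_map_iff] at d
  have hi : i = 0 := by
    by_contra hne
    have : ¬ D2 (G p) (i, ((0 : ℤ) : Z p)) :=
      not_D2_down (Nat.pos_of_ne_zero fun e => hne (Fin.ext e)) (by omega)
    exact this (by simpa using d)
  subst hi
  have r := rigid hp (α.trans (E p ts).symm) (by
    show (E p ts).symm (α (0, 0)) = _
    rw [← h]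
    simp)
  ext1 v
  have := r v
  have h2 : (E p ts).symm (α v) = v := this
  have h3 := congrArg (E p ts) h2
  simpa using h3.symm

lemma E_bij {p : ℕ} (hp : 3 ≤ p) : Function.Bijective (E p) := ⟨E_inj p, E_surj hp⟩

end ATProof

namespace ATProof

lemma iso_dist_le {V : Type*} {H : SimpleGraph V} (hc : H.Connected) (β : H ≃g H) (u v : V) :
    H.dist (β u) (β v) ≤ H.dist u v := by
  obtain ⟨w, hw⟩ := hc.exists_walk_length_eq_dist u v
  rw [← hw]
  have := dist_le (w.map β.toHom)
  rwa [Walk.length_map] at this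

lemma iso_dist {V : Type*} {H : SimpleGraph V} (hc : H.Connected) (β : H ≃g H) (u v : V) :
    H.dist (β u) (β v) = H.dist u v := by
  apply le_antisymm (iso_dist_le hc β u v)
  simpa using iso_dist_le hc β.symm (β u) (β v)

lemma conn (p : ℕ) : (G p).Connected := by
  haveI : Nonempty (Fin (p + 1) × Z p) := ⟨(0, 0)⟩
  refine ⟨?_⟩
  rintro ⟨i, u⟩ ⟨k, v⟩
  obtain ⟨x, rfl⟩ := ZMod.intCast_surjective u
  obtain ⟨y, rfl⟩ := ZMod.intCast_surjective v
  obtain ⟨w, -⟩ := exists_walk k y _ i x rfl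
  exact ⟨w⟩

lemma sum_big (m : ℕ) (a : ℤ) (h : (m : ℤ) - 1 ≤ a) :
    2 * ∑ s ∈ Finset.range m, |(s : ℤ) - a| = m * (2 * a - m + 1) := by
  induction m with
  | zero => simp
  | succ m ih =>
    push_cast at h
    rw [Finset.sum_range_succ, mul_add, ih (by omega), abs_of_nonpos (by omega)]
    push_cast
    ring

lemma sum_abs (m : ℕ) (a : ℤ) (h : -1 ≤ a) (h' : a ≤ m) :
    2 * ∑ s ∈ Finset.range m, |(s : ℤ) - a| = a * (a + 1) + (m - 1 - a) * (m - a) := by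
  induction m with
  | zero =>
    have : a = -1 ∨ a = 0 := by push_cast at h'; omega
    rcases this with rfl | rfl <;> simp
  | succ m ih =>
    by_cases hm : a ≤ m
    · rw [Finset.sum_range_succ, mul_add, ih hm, abs_of_nonneg (by omega)]
      push_cast
      ring
    · have : a = m + 1 := by push_cast at h'; omega
      rw [sum_big _ _ (by push_cast; omega), this]
      push_cast
      ring

lemma sum_c (p : ℕ) (c : ℤ) (h : -(p : ℤ) - 1 ≤ c) (h' : c ≤ p + 1) :
    ∑ s : Fin (2 * p + 1), |(s : ℤ) - p - c| = p * (p + 1) + c ^ 2 := by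
  rw [Fin.sum_univ_eq_sum_range (fun s => |(s : ℤ) - p - c|)]
  have := sum_abs (2 * p + 1) (p + c) (by omega) (by push_cast; omega)
  simp only [sub_sub]
  push_cast at this
  linarith

lemma g_tot (i k q : ℤ) :
    ((g i 0 i (4 * q) + g i 0 i (4 * q + 1) + g i 0 k (4 * q - 1) + g i 0 k (4 * q + 2) : ℕ) : ℤ) =
      10 * |q - 0| + 2 * |q - (-1)| + |q - (1 + (k - i))| + |q - (-(k - i))| + |q - (k - i)| +
        |q - (-1 - (k - i))| := by
  unfold g
  have e1 : (4 * q + 1) / 2 = 2 * q := by omega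
  have e2 : (4 * q) / 4 = q := by omega
  have e3 : (4 * q + 2) / 4 = q := by omega
  have e4 : (4 * q + 1 + 1) / 2 = 2 * q + 1 := by omega
  have e5 : (4 * q + 1) / 4 = q := by omega
  have e6 : (4 * q + 1 + 2) / 4 = q := by omega
  have e7 : (4 * q - 1 + 1) / 2 = 2 * q := by omega
  have e8 : (4 * q - 1) / 4 = q - 1 := by omega
  have e9 : (4 * q - 1 + 2) / 4 = q := by omega
  have e10 : (4 * q + 2 + 1) / 2 = 2 * q + 1 := by omega
  have e11 : (4 * q + 2 + 2) / 4 = q + 1 := by omega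
  rw [e1, e2, e3, e4, e5, e6, e7, e8, e9, e10, e11]
  simp only [Int.abs_eq_natAbs]
  generalize hd : k - i = d
  have hk : k = d + i := by omega
  subst hk
  have f1 : (q - (d + i) - (0 / 4 - i)).natAbs = (q - d).natAbs := by omega
  have f2 : (q - 1 - (d + i) - (0 / 4 - i)).natAbs = (q - (1 + d)).natAbs := by omega
  have f3 : (q + (d + i) - ((0 + 2) / 4 + i)).natAbs = (q - (-d)).natAbs := by omega
  have f4 : (q + 1 + (d + i) - ((0 + 2) / 4 + i)).natAbs = (q - (-1 - d)).natAbs := by omega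
  rw [f1, f2, f3, f4]
  generalize (q - d).natAbs = z1
  generalize (q - (1 + d)).natAbs = z2
  generalize (q - (-d)).natAbs = z3
  generalize (q - (-1 - d)).natAbs = z4
  omega

lemma sum_g {p : ℕ} (i : Fin (p + 1)) :
    ∑ s : Fin (2 * p + 1), (((g i 0 i (4 * ((s : ℤ) - p)) + g i 0 i (4 * ((s : ℤ) - p) + 1) +
      g i 0 (Fin.rev i : Fin (p + 1)) (4 * ((s : ℤ) - p) - 1) +
      g i 0 (Fin.rev i : Fin (p + 1)) (4 * ((s : ℤ) - p) + 2) : ℕ)) : ℤ) =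
      16 * (p * (p + 1)) + 4 + 4 * ((p : ℤ) - 2 * (i : ℕ)) ^ 2 + 4 * ((p : ℤ) - 2 * (i : ℕ)) := by
  have hi := i.2
  simp only [g_tot]
  rw [cast_rev]
  simp only [Finset.sum_add_distrib, ← Finset.mul_sum]
  rw [sum_c, sum_c, sum_c, sum_c, sum_c, sum_c] <;> first | omega | ring

lemma sum_i (m : ℕ) (A c : ℚ) :
    ∑ i ∈ Finset.range m, (A + 4 * (c - 2 * (i : ℚ)) ^ 2 + 4 * (c - 2 * (i : ℚ))) =
      m * A + 4 * c ^ 2 * m + 4 * c * m - (16 * c + 8) * (m * (m - 1) / 2) +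
        16 * ((m - 1) * m * (2 * m - 1) / 6) := by
  induction m with
  | zero => simp
  | succ m ih => rw [Finset.sum_range_succ, ih]; push_cast; ring

lemma sum_aut {p : ℕ} (hp : 3 ≤ p) [Fintype (G p ≃g G p)] (i : Fin (p + 1)) :
    ∑ α : G p ≃g G p, ((G p).dist (i, 0) (α (i, 0)) : ℚ) =
      16 * (p * (p + 1)) + 4 + 4 * ((p : ℚ) - 2 * ((i : ℕ) : ℚ)) ^ 2 +
        4 * ((p : ℚ) - 2 * ((i : ℕ) : ℚ)) := by
  rw [← (E_bij hp).sum_comp (fun α : G p ≃g G p => ((G p).dist (i, 0) (α (i, 0)) : ℚ))]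
  rw [Fintype.sum_prod_type_right]
  have h := sum_g i
  have h' := congrArg (Int.cast : ℤ → ℚ) h
  push_cast at h'
  rw [← h']
  apply Finset.sum_congr rfl
  intro s _
  have hs := s.2
  rw [Fin.sum_univ_four, E0, E1, E2, E3, dist_eq, dist_eq, dist_eq, dist_eq] <;> omega

lemma main {p : ℕ} (hp : 3 ≤ p) : GPindex (G p) =
    ((p : ℚ) + 1) * (4 * p + 2) * ((p + 1) * (16 * (p * (p + 1)) + 4) + 4 * p * (p + 1) * (p + 2) / 3) := by
  classical
  haveI : Finite (G p ≃g G p) := Finite.of_surjective _ (E_surj hp)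
  haveI : Fintype (G p ≃g G p) := Fintype.ofFinite _
  have hcard : Nat.card (G p ≃g G p) = 4 * (2 * p + 1) := by
    rw [← Nat.card_congr (Equiv.ofBijective _ (E_bij hp))]
    simp
  have hV : Nat.card (Fin (p + 1) × Z p) = (p + 1) * (2 * (4 * p + 2)) := by
    simp [Nat.card_prod]
  have hbij : Function.Bijective
      (fun a : (G p ≃g G p) × Fin (p + 1) => a.1 ((a.2, 0) : Fin (p + 1) × Z p)) := by
    apply Function.Surjective.bijective_of_nat_card_le
    · intro v
      obtain ⟨ts, i, h⟩ := exists_E v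
      exact ⟨(E p ts, i), h⟩
    · rw [hV, Nat.card_prod, hcard, Nat.card_fin]
      apply le_of_eq
      ring
  unfold GPindex
  rw [finsum_eq_sum_of_fintype]
  simp only [finsum_eq_sum_of_fintype]
  rw [← hbij.sum_comp]
  have hconj : ∀ (β : G p ≃g G p) (v : Fin (p + 1) × Z p),
      ∑ α : G p ≃g G p, ((G p).dist (β v) (α (β v)) : ℚ) =
      ∑ α : G p ≃g G p, ((G p).dist v (α v) : ℚ) := by
    intro β v
    symm
    apply Fintype.sum_equiv (MulAut.conj β).toEquiv
    intro α
    have : (MulAut.conj β) α (β v) = β (α v) := by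
      simp [MulAut.conj_apply, RelIso.mul_apply]
    show ((G p).dist v (α v) : ℚ) = ((G p).dist (β v) ((MulAut.conj β) α (β v)) : ℚ)
    rw [this, iso_dist (conn p)]
  simp only [hconj, sum_aut hp]
  rw [Fintype.sum_prod_type]
  simp only [Finset.sum_const, Finset.card_univ, nsmul_eq_mul]
  rw [Fin.sum_univ_eq_sum_range (fun i => (16 * ((p : ℚ) * (p + 1)) + 4 +
    4 * ((p : ℚ) - 2 * (i : ℚ)) ^ 2 + 4 * ((p : ℚ) - 2 * (i : ℚ)))), sum_i]
  rw [← Nat.card_eq_fintype_card, hV, hcard]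
  push_cast
  field_simp
  ring

end ATProof

theorem stmt15 (n p : ℕ) (hp : 3 ≤ p) (hn : n = 4 * p + 2) :
    GPindex (AT n p) =
      ((p : ℚ) + 1) * ((n : ℚ) ^ 3 * (p : ℚ) + 3 * (n : ℚ) ^ 3 / 4 +
        2 * (n : ℚ) ^ 2 * (p : ℚ) + (n : ℚ) ^ 2 + 4 * (n : ℚ) * (p : ℚ) ^ 3 / 3 -
        4 * (n : ℚ) * (p : ℚ) / 3 - (n : ℚ)) := by
  subst hn
  have h := ATProof.main hp
  rw [show GPindex (AT (4 * p + 2) p) = GPindex (ATProof.G p) from rfl, h]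
  push_cast
  ring
end

section
/- Let p ≥ 4 be an even integer and n an integer divisible by 4 with 16 ≤ n ≤ 4p. Then the Graovac–Pisanski index of AT(n,p) satisfies Ŵ(AT(n,p)) = (p+1)·(n⁴/48 + (3n³p)/4 + (3n³)/4 + n²p² + 2n²p + (2n²)/3). -/
open SimpleGraph

/-- Brick wall relation. -/
def BWRel (n p : ℕ) (u v : ZMod n × Fin (2 * p + 2)) : Prop :=
  (u.1 = v.1 ∧ (u.2 : ℕ) + 1 = (v.2 : ℕ)) ∨
    (u.2 = v.2 ∧ v.1 = u.1 + 1 ∧ (u.1.val + (u.2 : ℕ)) % 2 = 0)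

/-- The brick wall model of the nanotube. -/
def BW (n p : ℕ) : SimpleGraph (ZMod n × Fin (2 * p + 2)) :=
  SimpleGraph.fromRel (BWRel n p)

theorem zmod_succ_iff {N : ℕ} (hN : 2 ≤ N) (a b : ZMod N) :
    b = a + 1 ↔ (b.val = a.val + 1 ∨ (a.val + 1 = N ∧ b.val = 0)) := by
  have : NeZero N := ⟨by omega⟩
  have : Fact (1 < N) := ⟨by omega⟩
  have ha := ZMod.val_lt a
  have hb := ZMod.val_lt b
  rw [← (ZMod.val_injective N).eq_iff, ZMod.val_add, ZMod.val_one]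
  by_cases h : a.val + 1 = N
  · rw [h, Nat.mod_self]; omega
  · rw [Nat.mod_eq_of_lt (by omega)]; omega

theorem BW_adj {n p : ℕ} (hn : 2 ≤ n) (u v : ZMod n × Fin (2 * p + 2)) :
    (BW n p).Adj u v ↔ (BWRel n p u v ∨ BWRel n p v u) := by
  unfold BW
  rw [SimpleGraph.fromRel_adj]
  constructor
  · exact fun h => h.2
  · intro h
    refine ⟨?_, h⟩
    rintro rfl
    have : BWRel n p u u := (or_self_iff.1 h)
    rcases this with h | h
    · omega
    · have := (zmod_succ_iff hn _ _).1 h.2.1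
      omega

theorem AT_adj {n p : ℕ} (hn : 2 ≤ n) (u v : Fin (p + 1) × ZMod (2 * n)) :
    (AT n p).Adj u v ↔ (ATRel n p u v ∨ ATRel n p v u) := by
  unfold AT
  rw [SimpleGraph.fromRel_adj]
  constructor
  · exact fun h => h.2
  · intro h
    refine ⟨?_, h⟩
    rintro rfl
    have : ATRel n p u u := (or_self_iff.1 h)
    rcases this with h | h
    · have := (zmod_succ_iff (by omega) _ _).1 h.2
      omega
    · omega

/-- The coordinate change from the nanotube to the brick wall. -/
def toBW (n p : ℕ) (u : Fin (p + 1) × ZMod (2 * n)) : ZMod n × Fin (2 * p + 2) :=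
  ((((u.2.val + 1) / 2 : ℕ) : ZMod n), ⟨2 * (u.1 : ℕ) + (u.2.val % 4) / 2, by omega⟩)

theorem toBW_val {n p : ℕ} (hn : 2 ≤ n) (u : Fin (p + 1) × ZMod (2 * n)) :
    (u.2.val + 1 = 2 * n ∧ (toBW n p u).1.val = 0) ∨
      (u.2.val + 1 < 2 * n ∧ (toBW n p u).1.val = (u.2.val + 1) / 2) := by
  have : NeZero (2 * n) := ⟨by omega⟩
  have h := ZMod.val_lt u.2
  unfold toBW
  simp only [ZMod.val_natCast]
  by_cases h1 : u.2.val + 1 = 2 * n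
  · left
    refine ⟨h1, ?_⟩
    have : (u.2.val + 1) / 2 = n := by omega
    rw [this, Nat.mod_self]
  · right
    refine ⟨by omega, Nat.mod_eq_of_lt (by omega)⟩

theorem toBW_bij {n p : ℕ} (hn : 2 ≤ n) (h4 : 4 ∣ n) : Function.Bijective (toBW n p) := by
  have : NeZero (2 * n) := ⟨by omega⟩
  have : NeZero n := ⟨by omega⟩
  rw [Fintype.bijective_iff_injective_and_card]
  constructor
  · intro u v h
    have hu := toBW_val hn u
    have hv := toBW_val hn v
    rw [h] at hu
    have h2 : ((toBW n p u).2 : ℕ) = (toBW n p v).2 := by rw [h]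
    simp only [toBW] at h2
    have h3 := ZMod.val_lt u.2
    have h4 := ZMod.val_lt v.2
    ext1
    · apply Fin.ext; omega
    · apply ZMod.val_injective; omega
  · simp only [Fintype.card_prod, ZMod.card, Fintype.card_fin]; ring

set_option maxHeartbeats 4000000 in
theorem toBW_rel {n p : ℕ} (hn : 2 ≤ n) (h4 : 4 ∣ n) (u v : Fin (p + 1) × ZMod (2 * n)) :
    (BW n p).Adj (toBW n p u) (toBW n p v) ↔ (AT n p).Adj u v := by
  have : NeZero (2 * n) := ⟨by omega⟩
  have : NeZero n := ⟨by omega⟩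
  rw [BW_adj hn, AT_adj hn]
  unfold BWRel ATRel
  have e1 : v.2 = u.2 - 1 ↔ u.2 = v.2 + 1 := by
    constructor <;> intro h <;> rw [h] <;> ring
  have e2 : u.2 = v.2 - 1 ↔ v.2 = u.2 + 1 := by
    constructor <;> intro h <;> rw [h] <;> ring
  rw [e1, e2]
  simp only [zmod_succ_iff hn, zmod_succ_iff (show 2 ≤ 2 * n by omega), Fin.ext_iff,
    ← (ZMod.val_injective n).eq_iff]
  have hu := toBW_val hn u
  have hv := toBW_val hn v
  have h2 : ((toBW n p u).2 : ℕ) = 2 * (u.1 : ℕ) + (u.2.val % 4) / 2 := rfl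
  have h3 : ((toBW n p v).2 : ℕ) = 2 * (v.1 : ℕ) + (v.2.val % 4) / 2 := rfl
  have h5 := ZMod.val_lt u.2
  have h6 := ZMod.val_lt v.2
  generalize (toBW n p u).1.val = C at *
  generalize (toBW n p v).1.val = C' at *
  generalize ((toBW n p u).2 : ℕ) = H at *
  generalize ((toBW n p v).2 : ℕ) = H' at *
  generalize u.2.val = J at *
  generalize v.2.val = J' at *
  generalize (u.1 : ℕ) = I at *
  generalize (v.1 : ℕ) = I' at *
  clear e1 e2
  obtain ⟨m, rfl⟩ := h4
  constructor
  · rintro ((⟨h, h'⟩ | ⟨h, h' | h', h''⟩) | (⟨h, h'⟩ | ⟨h, h' | h', h''⟩)) <;>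
    rcases hu with ⟨hu, hu'⟩ | ⟨hu, hu'⟩ <;> rcases hv with ⟨hv, hv'⟩ | ⟨hv, hv'⟩ <;>
    have hr : J % 4 = 0 ∨ J % 4 = 1 ∨ J % 4 = 2 ∨ J % 4 = 3 := (by omega) <;>
    rcases hr with hr | hr | hr | hr <;>
    first
    | (exfalso; omega)
    | (left; left; omega)
    | (right; left; omega)
    | (left; right; omega)
    | (right; right; omega)
  · rintro ((⟨h, h' | h'⟩ | ⟨h, ⟨h', h''⟩ | ⟨h', h''⟩⟩) | (⟨h, h' | h'⟩ | ⟨h, ⟨h', h''⟩ | ⟨h', h''⟩⟩)) <;>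
    rcases hu with ⟨hu, hu'⟩ | ⟨hu, hu'⟩ <;> rcases hv with ⟨hv, hv'⟩ | ⟨hv, hv'⟩ <;>
    have hr : J % 4 = 0 ∨ J % 4 = 1 ∨ J % 4 = 2 ∨ J % 4 = 3 := (by omega) <;>
    rcases hr with hr | hr | hr | hr <;>
    first
    | (exfalso; omega)
    | (left; left; omega)
    | (right; left; omega)
    | (left; right; omega)
    | (right; right; omega)

/-- The isomorphism. -/
noncomputable def isoBW {n p : ℕ} (hn : 2 ≤ n) (h4 : 4 ∣ n) : AT n p ≃g BW n p where
  toEquiv := Equiv.ofBijective _ (toBW_bij hn h4)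
  map_rel_iff' := by
    intro a b
    exact toBW_rel hn h4 a b

theorem iso_dist {V W : Type*} {G : SimpleGraph V} {H : SimpleGraph W} (e : G ≃g H)
    (u v : V) : H.dist (e u) (e v) = G.dist u v := by
  simp only [SimpleGraph.dist, SimpleGraph.edist]
  congr 1
  apply le_antisymm
  · refine le_iInf fun w => ?_
    refine (iInf_le _ (w.map e.toHom)).trans ?_
    simp
  · refine le_iInf fun w => ?_
    refine (iInf_le _ ((w.map e.symm.toHom).copy (e.symm_apply_apply u) (e.symm_apply_apply v))).trans ?_
    simp

theorem GPindex_iso {V W : Type*} {G : SimpleGraph V} {H : SimpleGraph W} (e : G ≃g H) :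
    GPindex G = GPindex H := by
  let E : (G ≃g G) ≃ (H ≃g H) :=
    { toFun := fun a => (e.symm.trans a).trans e
      invFun := fun a => (e.trans a).trans e.symm
      left_inv := fun a => by ext; simp
      right_inv := fun a => by ext; simp }
  unfold GPindex
  rw [Nat.card_congr e.toEquiv, Nat.card_congr E]
  congr 1
  refine finsum_eq_of_bijective e e.bijective fun u => ?_
  refine finsum_eq_of_bijective E E.bijective fun a => ?_
  have : (E a) (e u) = e (a u) := by simp [E]
  rw [this, iso_dist]

theorem val_add_par {n : ℕ} (h2 : 2 ∣ n) (hn : 2 ≤ n) (a b : ZMod n) :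
    (a + b).val % 2 = (a.val + b.val) % 2 := by
  have : NeZero n := ⟨by omega⟩
  rw [ZMod.val_add, Nat.mod_mod_of_dvd _ h2]

theorem val_sub_par {n : ℕ} (h2 : 2 ∣ n) (hn : 2 ≤ n) (a b : ZMod n) :
    (a - b).val % 2 = (a.val + b.val) % 2 := by
  have := val_add_par h2 hn (a - b) b
  rw [sub_add_cancel] at this
  omega

theorem val_neg_par {n : ℕ} (h2 : 2 ∣ n) (hn : 2 ≤ n) (a : ZMod n) :
    (-a).val % 2 = a.val % 2 := by
  have := val_sub_par h2 hn 0 a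
  rw [zero_sub, ZMod.val_zero] at this
  omega

theorem val_one_of {n : ℕ} (hn : 2 ≤ n) : (1 : ZMod n).val = 1 := by
  have : Fact (1 < n) := ⟨by omega⟩
  exact ZMod.val_one n

/-- The automorphisms of the brick wall, as maps. -/
def bwMap (n p : ℕ) (s : ZMod n) (f : Bool) (u : ZMod n × Fin (2 * p + 2)) :
    ZMod n × Fin (2 * p + 2) :=
  (if (s.val + f.toNat) % 2 = 0 then s + u.1 else s - u.1, if f then Fin.rev u.2 else u.2)

theorem bwMap_rel {n p : ℕ} (h2 : 2 ∣ n) (hn : 2 ≤ n) (s : ZMod n) (f : Bool)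
    (u v : ZMod n × Fin (2 * p + 2)) (h : BWRel n p u v) :
    BWRel n p (bwMap n p s f u) (bwMap n p s f v) ∨
      BWRel n p (bwMap n p s f v) (bwMap n p s f u) := by
  obtain ⟨c, r⟩ := u
  obtain ⟨c', r'⟩ := v
  have hr := r.isLt
  have hr' := r'.isLt
  rcases h with ⟨h, h'⟩ | ⟨h, h', h''⟩
  · simp only at h h'
    subst h
    cases f
    · left; left
      simpa [bwMap] using h'
    · right; left
      simp only [bwMap, if_true, Fin.val_rev, true_and]
      omega
  · simp only at h h' h''
    subst h h'
    by_cases hs : (s.val + f.toNat) % 2 = 0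
    · left; right
      simp only [bwMap, hs, if_true]
      refine ⟨trivial, by ring, ?_⟩
      have := val_add_par h2 hn s c
      cases f <;> simp [Fin.val_rev] at hs ⊢ <;> omega
    · right; right
      simp only [bwMap, hs, if_false]
      refine ⟨trivial, by ring, ?_⟩
      have := val_sub_par h2 hn s (c + 1)
      have := val_add_par h2 hn c 1
      have := val_one_of hn
      cases f <;> simp [Fin.val_rev] at hs ⊢ <;> omega

theorem bwMap_adj {n p : ℕ} (h2 : 2 ∣ n) (hn : 2 ≤ n) (s : ZMod n) (f : Bool)
    (u v : ZMod n × Fin (2 * p + 2)) (h : (BW n p).Adj u v) :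
    (BW n p).Adj (bwMap n p s f u) (bwMap n p s f v) := by
  rw [BW_adj hn] at h ⊢
  rcases h with h | h
  · exact bwMap_rel h2 hn s f u v h
  · exact (bwMap_rel h2 hn s f v u h).symm

/-- Parameter of the inverse. -/
def bwInv (n : ℕ) (s : ZMod n) (f : Bool) : ZMod n :=
  if (s.val + f.toNat) % 2 = 0 then -s else s

theorem bwInv_left {n p : ℕ} (h2 : 2 ∣ n) (hn : 2 ≤ n) (s : ZMod n) (f : Bool)
    (u : ZMod n × Fin (2 * p + 2)) :
    bwMap n p (bwInv n s f) f (bwMap n p s f u) = u := by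
  have := val_neg_par h2 hn s
  have h1 : ((-s).val + f.toNat) % 2 = (s.val + f.toNat) % 2 := by omega
  by_cases hs : (s.val + f.toNat) % 2 = 0
  · have hs' := hs
    rw [← h1] at hs'
    cases f <;> simp only [bwMap, bwInv, hs, hs', if_true] <;> simp
  · cases f <;> simp only [bwMap, bwInv, hs, if_false] <;> simp

theorem bwInv_right {n p : ℕ} (h2 : 2 ∣ n) (hn : 2 ≤ n) (s : ZMod n) (f : Bool)
    (u : ZMod n × Fin (2 * p + 2)) :
    bwMap n p s f (bwMap n p (bwInv n s f) f u) = u := by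
  have := val_neg_par h2 hn s
  have h1 : ((-s).val + f.toNat) % 2 = (s.val + f.toNat) % 2 := by omega
  by_cases hs : (s.val + f.toNat) % 2 = 0
  · have hs' := hs
    rw [← h1] at hs'
    cases f <;> simp only [bwMap, bwInv, hs, hs', if_true] <;> simp
  · cases f <;> simp only [bwMap, bwInv, hs, if_false] <;> simp

/-- The automorphisms of the brick wall. -/
def bwAut {n p : ℕ} (h2 : 2 ∣ n) (hn : 2 ≤ n) (x : ZMod n × Bool) : BW n p ≃g BW n p where
  toFun := bwMap n p x.1 x.2
  invFun := bwMap n p (bwInv n x.1 x.2) x.2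
  left_inv := bwInv_left h2 hn x.1 x.2
  right_inv := bwInv_right h2 hn x.1 x.2
  map_rel_iff' := by
    intro a b
    constructor
    · intro h
      have := bwMap_adj h2 hn (bwInv n x.1 x.2) x.2 _ _ h
      simpa only [Equiv.coe_fn_mk, bwInv_left h2 hn] using this
    · exact bwMap_adj h2 hn x.1 x.2 a b

theorem bwAut_apply {n p : ℕ} (h2 : 2 ∣ n) (hn : 2 ≤ n) (x : ZMod n × Bool)
    (u : ZMod n × Fin (2 * p + 2)) : bwAut h2 hn x u = bwMap n p x.1 x.2 u := rfl

theorem bwMap_zero {n p : ℕ} (s : ZMod n) (f : Bool) (r : Fin (2 * p + 2)) :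
    bwMap n p s f (0, r) = (s, if f then Fin.rev r else r) := by
  simp [bwMap]

/-- Degree at most two. -/
def P0 {V : Type*} (G : SimpleGraph V) (v : V) : Prop :=
  ∃ a b, ∀ w, G.Adj v w → w = a ∨ w = b

theorem P0_map {V : Type*} {G : SimpleGraph V} (e : G ≃g G) {v : V} (h : P0 G v) :
    P0 G (e v) := by
  obtain ⟨a, b, h⟩ := h
  refine ⟨e a, e b, fun w hw => ?_⟩
  have : G.Adj v (e.symm w) := by
    rw [← e.map_adj_iff]; simpa using hw
  rcases h _ this with h | h
  · left; rw [← h]; simp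
  · right; rw [← h]; simp

theorem adj_up {n p : ℕ} (hn : 2 ≤ n) (c : ZMod n) (h : ℕ) (h1 : h < 2 * p + 2)
    (h2 : h + 1 < 2 * p + 2) : (BW n p).Adj (c, ⟨h, h1⟩) (c, ⟨h + 1, h2⟩) := by
  rw [BW_adj hn]; left; left; simp

theorem adj_right {n p : ℕ} (hn : 2 ≤ n) (c : ZMod n) (h : Fin (2 * p + 2))
    (hc : (c.val + h) % 2 = 0) : (BW n p).Adj (c, h) (c + 1, h) := by
  rw [BW_adj hn]; left; right; exact ⟨rfl, rfl, hc⟩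

theorem adj_left {n p : ℕ} (h2 : 2 ∣ n) (hn : 2 ≤ n) (c : ZMod n) (h : Fin (2 * p + 2))
    (hc : (c.val + h) % 2 = 1) : (BW n p).Adj (c, h) (c - 1, h) := by
  have e := adj_right hn (c - 1) h (by
    have := val_sub_par h2 hn c 1
    rw [val_one_of hn] at this
    omega)
  rw [sub_add_cancel] at e
  exact e.symm

/-- Neighbours of a vertex. -/
theorem nbr {n p : ℕ} (h2 : 2 ∣ n) (hn : 2 ≤ n) {c : ZMod n} {h : Fin (2 * p + 2)}
    {w : ZMod n × Fin (2 * p + 2)}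
    (H : (BW n p).Adj (c, h) w) :
    (w.1 = c ∧ (w.2 : ℕ) = h + 1) ∨ (w.1 = c ∧ (w.2 : ℕ) + 1 = h) ∨
    (w.2 = h ∧ w.1 = c + 1 ∧ (c.val + h) % 2 = 0) ∨
    (w.2 = h ∧ w.1 = c - 1 ∧ (c.val + h) % 2 = 1) := by
  rw [BW_adj hn] at H
  obtain ⟨c', h'⟩ := w
  rcases H with (⟨H, H'⟩ | ⟨H, H', H''⟩) | (⟨H, H'⟩ | ⟨H, H', H''⟩)
  · left; exact ⟨H.symm, H'.symm⟩
  · right; right; left; exact ⟨H.symm, H', H''⟩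
  · right; left; exact ⟨H, H'⟩
  · right; right; right
    simp only at H H' H''
    subst H H'
    refine ⟨rfl, by ring, ?_⟩
    have := val_add_par h2 hn c' 1
    rw [val_one_of hn] at this
    omega

theorem P0_row0 {n p : ℕ} (h2 : 2 ∣ n) (hn : 2 ≤ n) (c : ZMod n) :
    P0 (BW n p) (c, ⟨0, by omega⟩) := by
  refine ⟨(c, ⟨1, by omega⟩), (if c.val % 2 = 0 then c + 1 else c - 1, ⟨0, by omega⟩), ?_⟩
  rintro ⟨c', h'⟩ H
  rcases nbr h2 hn H with H | H | H | H
  · left; ext1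
    · exact H.1
    · apply Fin.ext; simpa using H.2
  · simp at H
  · right
    have h3 := H.2.2
    simp only [add_zero] at h3
    rw [if_pos h3]
    ext1
    · exact H.2.1
    · exact H.1
  · right
    have h3 := H.2.2
    simp only [add_zero] at h3
    rw [if_neg (by omega)]
    ext1
    · exact H.2.1
    · exact H.1

theorem P0_row {n p : ℕ} (h2 : 2 ∣ n) (hn : 2 ≤ n) (v : ZMod n × Fin (2 * p + 2))
    (h : P0 (BW n p) v) : (v.2 : ℕ) = 0 ∨ (v.2 : ℕ) = 2 * p + 1 := by
  obtain ⟨c, r, hr⟩ := v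
  by_contra hc
  simp only [not_or] at hc
  obtain ⟨k, rfl⟩ : ∃ k, r = k + 1 := ⟨r - 1, by omega⟩
  obtain ⟨a, b, h⟩ := h
  have e1 := h _ (adj_up hn c (k + 1) hr (by omega))
  have e2 := h _ (adj_up hn c k (by omega) hr).symm
  have e3 : ∃ d, (d, ⟨k + 1, hr⟩) = a ∨ (d, (⟨k + 1, hr⟩ : Fin (2 * p + 2))) = b := by
    rcases Nat.mod_two_eq_zero_or_one (c.val + (k + 1)) with h0 | h0
    · exact ⟨_, h _ (adj_right hn c ⟨k + 1, hr⟩ h0)⟩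
    · exact ⟨_, h _ (adj_left h2 hn c ⟨k + 1, hr⟩ h0)⟩
  obtain ⟨d, e3⟩ := e3
  have cg : ∀ x y : ZMod n × Fin (2 * p + 2), x = y → (x.2 : ℕ) = y.2 := by
    rintro x y rfl; rfl
  have f1 := e1.imp (cg _ _) (cg _ _)
  have f2 := e2.imp (cg _ _) (cg _ _)
  have f3 := e3.imp (cg _ _) (cg _ _)
  simp only at f1 f2 f3
  omega

theorem fix_nbr {V : Type*} {G : SimpleGraph V} (e : G ≃g G) (Q : V → Prop) {v w : V}
    (hv : e v = v) (hw : G.Adj v w) (hQ : Q (e w))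
    (H : ∀ w', G.Adj v w' → Q w' → w' = w ∨ e w' = w') : e w = w := by
  have h1 : G.Adj v (e w) := by
    have := (e.map_adj_iff).2 hw
    rwa [hv] at this
  rcases H _ h1 hQ with h | h
  · exact h
  · exact e.injective h

theorem bw_ext {n p : ℕ} {w : ZMod n × Fin (2 * p + 2)} {c : ZMod n} {h : ℕ}
    {hh : h < 2 * p + 2} (h1 : w.1 = c) (h2 : (w.2 : ℕ) = h) : w = (c, ⟨h, hh⟩) := by
  ext1
  · exact h1
  · apply Fin.ext; exact h2

theorem fix_step {n p : ℕ} (h2 : 2 ∣ n) (hn : 2 ≤ n) (hp : 2 ≤ p) (e : BW n p ≃g BW n p)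
    (c : ZMod n) (hc : c.val % 2 = 0) (hf : e (c, ⟨0, by omega⟩) = (c, ⟨0, by omega⟩)) :
    e (c + 1, ⟨0, by omega⟩) = (c + 1, ⟨0, by omega⟩) ∧
    e (c + 1 + 1, ⟨0, by omega⟩) = (c + 1 + 1, ⟨0, by omega⟩) := by
  have par1 := val_add_par h2 hn c 1
  have par2 := val_add_par h2 hn (c + 1) 1
  rw [val_one_of hn] at par1 par2
  have s1 : e (c + 1, ⟨0, by omega⟩) = (c + 1, ⟨0, by omega⟩) := by
    refine fix_nbr e (P0 (BW n p)) hf (adj_right hn c _ (by simpa using hc))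
      (P0_map e (P0_row0 h2 hn _)) ?_
    intro w hw hQ
    have := P0_row h2 hn w hQ
    rcases nbr h2 hn hw with H | H | H | H
    · simp only at H; omega
    · simp only at H; omega
    · left; exact bw_ext H.2.1 (by rw [H.1])
    · simp only at H; omega
  have s2 : e (c + 1, ⟨1, by omega⟩) = (c + 1, ⟨1, by omega⟩) := by
    refine fix_nbr e (fun _ => True) s1 (adj_up hn (c + 1) 0 _ _) trivial ?_
    intro w hw _
    rcases nbr h2 hn hw with H | H | H | H
    · left; exact bw_ext H.1 H.2
    · simp only at H; omega
    · simp only at H; omega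
    · right
      have : w = (c, ⟨0, by omega⟩) := bw_ext (by rw [H.2.1]; ring) (by rw [H.1])
      rw [this]; exact hf
  have s3 : e (c + 1 + 1, ⟨1, by omega⟩) = (c + 1 + 1, ⟨1, by omega⟩) := by
    refine fix_nbr e (fun v => ∃ w, (BW n p).Adj v w ∧ P0 (BW n p) w) s2
      (adj_right hn (c + 1) _ (by simp only; omega)) ?_ ?_
    · exact ⟨e (c + 1 + 1, ⟨0, by omega⟩), (e.map_adj_iff).2 (adj_up hn _ 0 _ _).symm,
        P0_map e (P0_row0 h2 hn _)⟩
    · rintro ⟨c', h'⟩ hw ⟨w', hw', hQ⟩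
      have hr := P0_row h2 hn w' hQ
      rcases nbr h2 hn hw with H | H | H | H
      · simp only at H
        have := nbr h2 hn hw'
        simp only [Fin.ext_iff] at this
        omega
      · right
        rw [bw_ext (c := c + 1) (h := 0) (hh := by omega) H.1 (by simpa using H.2)]
        exact s1
      · left; exact bw_ext H.2.1 (by rw [H.1])
      · simp only at H; omega
  refine ⟨s1, ?_⟩
  refine fix_nbr e (P0 (BW n p)) s3 (adj_up hn _ 0 _ _).symm (P0_map e (P0_row0 h2 hn _)) ?_
  intro w hw hQ
  have hr := P0_row h2 hn w hQ
  rcases nbr h2 hn hw with H | H | H | H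
  · simp only at H; omega
  · left; exact bw_ext H.1 (by simpa using H.2)
  · simp only [Fin.ext_iff] at H; omega
  · simp only [Fin.ext_iff] at H; omega

theorem fix_all {n p : ℕ} (h2 : 2 ∣ n) (hn : 2 ≤ n) (hp : 2 ≤ p) (e : BW n p ≃g BW n p)
    (hf : e (0, ⟨0, by omega⟩) = (0, ⟨0, by omega⟩)) (u : ZMod n × Fin (2 * p + 2)) :
    e u = u := by
  have hne : NeZero n := ⟨by omega⟩
  have ev : ∀ k : ℕ, e (((2 * k : ℕ) : ZMod n), ⟨0, by omega⟩) =
      (((2 * k : ℕ) : ZMod n), ⟨0, by omega⟩) := by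
    intro k
    induction k with
    | zero => simpa using hf
    | succ k ih =>
      have := (fix_step h2 hn hp e _ (by
        rw [ZMod.val_natCast, Nat.mod_mod_of_dvd _ h2]; omega) ih).2
      have h3 : ((2 * (k + 1) : ℕ) : ZMod n) = ((2 * k : ℕ) : ZMod n) + 1 + 1 := by
        push_cast; ring
      rw [h3]; exact this
  have row0 : ∀ c : ZMod n, e (c, ⟨0, by omega⟩) = (c, ⟨0, by omega⟩) := by
    intro c
    rcases Nat.mod_two_eq_zero_or_one c.val with h | h
    · have h3 : c = ((2 * (c.val / 2) : ℕ) : ZMod n) := by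
        rw [show 2 * (c.val / 2) = c.val by omega, ZMod.natCast_zmod_val]
      rw [h3]; exact ev _
    · have h3 : c = ((2 * (c.val / 2) : ℕ) : ZMod n) + 1 := by
        rw [← Nat.cast_add_one, show 2 * (c.val / 2) + 1 = c.val by omega, ZMod.natCast_zmod_val]
      rw [h3]
      exact (fix_step h2 hn hp e _ (by
        rw [ZMod.val_natCast, Nat.mod_mod_of_dvd _ h2]; omega) (ev _)).1
  have rows : ∀ h : ℕ, ∀ h' : ℕ, h' ≤ h → ∀ (hh : h' < 2 * p + 2) (c : ZMod n),
      e (c, ⟨h', hh⟩) = (c, ⟨h', hh⟩) := by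
    intro h
    induction h with
    | zero =>
      intro h' hle hh c
      obtain rfl : h' = 0 := by omega
      exact row0 c
    | succ h ih =>
      intro h' hle hh c
      rcases Nat.lt_or_ge h' (h + 1) with hlt | hge
      · exact ih h' (by omega) hh c
      · obtain rfl : h' = h + 1 := by omega
        refine fix_nbr e (fun _ => True) (ih h le_rfl (by omega) c) (adj_up hn c h _ _) trivial ?_
        rintro ⟨c', h', hh'⟩ hw _
        rcases nbr h2 hn hw with H | H | H | H
        · left; exact bw_ext H.1 H.2
        · right; exact ih h' (by simp only at H; omega) _ _
        · right; exact ih h' (by simp only [Fin.ext_iff] at H; omega) _ _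
        · right; exact ih h' (by simp only [Fin.ext_iff] at H; omega) _ _
  obtain ⟨c, h, hh⟩ := u
  exact rows h h le_rfl hh c

theorem bwAut_bij {n p : ℕ} (h2 : 2 ∣ n) (hn : 2 ≤ n) (hp : 2 ≤ p) :
    Function.Bijective (bwAut h2 hn : ZMod n × Bool → (BW n p ≃g BW n p)) := by
  constructor
  · rintro ⟨s, f⟩ ⟨s', f'⟩ h
    have h1 : bwAut (p := p) h2 hn (s, f) (0, 0) = bwAut h2 hn (s', f') (0, 0) := by rw [h]
    simp only [bwAut_apply, bwMap_zero, Prod.mk.injEq] at h1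
    obtain ⟨h1, h3⟩ := h1
    subst h1
    cases f <;> cases f' <;> simp [Fin.ext_iff] at h3 ⊢
  · intro a
    have h0 : P0 (BW n p) (0, 0) := P0_row0 h2 hn 0
    have h1 := P0_row h2 hn _ (P0_map a h0)
    have h3 : ∃ x, bwAut h2 hn x (0, 0) = a (0, 0) := by
      rcases h1 with h1 | h1
      · refine ⟨((a (0, 0)).1, false), ?_⟩
        rw [bwAut_apply, bwMap_zero]
        ext1
        · rfl
        · apply Fin.ext; simp [h1]
      · refine ⟨((a (0, 0)).1, true), ?_⟩
        rw [bwAut_apply, bwMap_zero]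
        ext1
        · rfl
        · apply Fin.ext; simp [h1]
    obtain ⟨x, hx⟩ := h3
    refine ⟨x, ?_⟩
    have := fix_all h2 hn hp (a.trans (bwAut h2 hn x).symm) (by
      change (bwAut h2 hn x).symm (a (0, 0)) = (0, 0)
      rw [← hx]; simp)
    ext1 u
    have h4 := this u
    change (bwAut h2 hn x).symm (a u) = u at h4
    conv_lhs => rw [← h4]
    simp

theorem dist_of_potential {V : Type*} {G : SimpleGraph V} (φ : V → ℕ) (u : V) (h0 : φ u = 0)
    (hl : ∀ v w, G.Adj v w → φ v ≤ φ w + 1)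
    (hd : ∀ v, v ≠ u → ∃ w, G.Adj v w ∧ φ w < φ v) (v : V) : G.dist u v = φ v := by
  have low : ∀ (v w : V) (q : G.Walk v w), φ v ≤ φ w + q.length := by
    intro v w q
    induction q with
    | nil => simp
    | cons h q ih =>
      have := hl _ _ h
      rw [Walk.length_cons]
      omega
  have up : ∀ k : ℕ, ∀ v, φ v ≤ k → ∃ q : G.Walk v u, q.length ≤ φ v := by
    intro k
    induction k with
    | zero =>
      intro v hv
      by_cases hvu : v = u
      · subst hvu; exact ⟨Walk.nil, by simp⟩
      · obtain ⟨w, _, h⟩ := hd v hvu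
        omega
    | succ k ih =>
      intro v hv
      by_cases hvu : v = u
      · subst hvu; exact ⟨Walk.nil, by simp⟩
      · obtain ⟨w, ha, h⟩ := hd v hvu
        obtain ⟨q, hq⟩ := ih w (by omega)
        exact ⟨Walk.cons ha q, by rw [Walk.length_cons]; omega⟩
  obtain ⟨q, hq⟩ := up _ v le_rfl
  rw [SimpleGraph.dist_comm]
  apply le_antisymm
  · exact (SimpleGraph.dist_le q).trans hq
  · obtain ⟨q', hq'⟩ := (Walk.reachable q).exists_walk_length_eq_dist
    rw [← hq']
    have := low _ _ q'
    omega

/-- Distance formula in the brick wall. -/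
def bwD (n t y : ℕ) : ℕ :=
  if (t + y) % 2 = 0 then min (t + max y t) ((n - t) + max y (n - t))
  else min (t + max y (t - 1)) ((n - t) + max y (n - t + 1))

theorem bwD_le1 {n t y t' y' : ℕ} (h2 : 2 ∣ n) (ht : t < n) (ht' : t' < n)
    (h : (t = t' ∧ (y = y' + 1 ∨ y' = y + 1)) ∨
      (y = y' ∧ (t + y) % 2 = 0 ∧ (t' = t + 1 ∨ (t + 1 = n ∧ t' = 0))) ∨
      (y = y' ∧ (t' + y') % 2 = 0 ∧ (t = t' + 1 ∨ (t' + 1 = n ∧ t = 0)))) :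
    bwD n t y ≤ bwD n t' y' + 1 := by
  unfold bwD
  obtain ⟨m, rfl⟩ := h2
  rcases h with ⟨rfl, rfl | rfl⟩ | ⟨rfl, h, rfl | ⟨h', rfl⟩⟩ | ⟨rfl, h, rfl | ⟨h', rfl⟩⟩ <;>
    split_ifs <;> omega

theorem bwD_dec_y {m t y : ℕ} (ht : t < 2 * m)
    (h : ((t + y) % 2 = 1 ∧ t ≤ 2 * m - t) ∨ ((t + y) % 2 = 0 ∧ (2 * m - t < t ∨ t = 0))) :
    bwD (2 * m) t y < bwD (2 * m) t (y + 1) := by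
  unfold bwD
  rcases h with ⟨h, h'⟩ | ⟨h, h'⟩
  · rw [if_neg (by omega), if_pos (by omega)]
    omega
  · rw [if_pos (by omega), if_neg (by omega)]
    omega

theorem bwD_dec_z {m t : ℕ} (ht : t < 2 * m) (h0 : t ≠ 0)
    (h : (t % 2 = 0 ∧ t ≤ 2 * m - t) ∨ (t % 2 = 1 ∧ 2 * m - t < t)) :
    bwD (2 * m) t 1 < bwD (2 * m) t 0 := by
  unfold bwD
  rcases h with ⟨h, h'⟩ | ⟨h, h'⟩
  · rw [if_neg (by omega), if_pos (by omega)]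
    omega
  · rw [if_pos (by omega), if_neg (by omega)]
    omega

theorem bwD_dec_r {m t y t' : ℕ} (ht : t < 2 * m) (h : (t + y) % 2 = 0)
    (h' : 2 * m - t < t) (e : t' = t + 1 ∨ (t + 1 = 2 * m ∧ t' = 0)) :
    bwD (2 * m) t' y < bwD (2 * m) t y := by
  unfold bwD
  rw [if_pos (c := (t + y) % 2 = 0) h, if_neg (by omega)]
  rcases e with rfl | ⟨e, rfl⟩ <;> omega

theorem bwD_dec_l {m t y : ℕ} (ht : t + 1 < 2 * m) (h : (t + 1 + y) % 2 = 1)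
    (h' : t + 1 ≤ 2 * m - (t + 1)) :
    bwD (2 * m) t y < bwD (2 * m) (t + 1) y := by
  unfold bwD
  rw [if_neg (c := (t + 1 + y) % 2 = 0) (by omega), if_pos (by omega)]
  omega

theorem bw_dist {n p : ℕ} (h2 : 2 ∣ n) (hn : 2 ≤ n) (h0 : Fin (2 * p + 2))
    (he : (h0 : ℕ) % 2 = 0) (v : ZMod n × Fin (2 * p + 2)) :
    (BW n p).dist (0, h0) v =
      bwD n v.1.val (((v.2 : ℕ) - (h0 : ℕ)) + ((h0 : ℕ) - (v.2 : ℕ))) := by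
  have hne : NeZero n := ⟨by omega⟩
  refine dist_of_potential
    (fun v => bwD n v.1.val (((v.2 : ℕ) - (h0 : ℕ)) + ((h0 : ℕ) - (v.2 : ℕ)))) _ ?_ ?_ ?_ v
  · simp [bwD]
  · intro v w hvw
    have hv := ZMod.val_lt v.1
    have hw := ZMod.val_lt w.1
    apply bwD_le1 h2 hv hw
    rw [BW_adj hn] at hvw
    unfold BWRel at hvw
    simp only [zmod_succ_iff hn, Fin.ext_iff, ← (ZMod.val_injective n).eq_iff] at hvw
    rcases hvw with (h | h) | (h | h)
    · left; omega
    · right; left; omega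
    · left; omega
    · right; right; omega
  · rintro ⟨c, r, hr⟩ hne'
    have hc := ZMod.val_lt c
    have hlt := h0.isLt
    have hne2 : ¬ (c.val = 0 ∧ r = h0) := by
      rintro ⟨h1, h3⟩
      apply hne'
      ext1
      · exact (ZMod.val_eq_zero c).1 h1
      · exact Fin.ext h3
    have h2' := h2
    obtain ⟨m, rfl⟩ := h2
    simp only
    -- vertical moves
    have vert : ∀ r' : ℕ, r' < 2 * p + 2 → (r' = r + 1 ∨ r = r' + 1) →
        bwD (2 * m) c.val ((r' - h0) + (h0 - r')) < bwD (2 * m) c.val ((r - h0) + (h0 - r)) →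
        ∃ w, (BW (2 * m) p).Adj (c, ⟨r, hr⟩) w ∧
          bwD (2 * m) w.1.val (((w.2 : ℕ) - (h0 : ℕ)) + ((h0 : ℕ) - (w.2 : ℕ))) <
          bwD (2 * m) c.val ((r - h0) + (h0 - r)) := by
      intro r' h1 h3 h4
      refine ⟨(c, ⟨r', h1⟩), ?_, h4⟩
      rcases h3 with rfl | rfl
      · exact adj_up hn c r hr h1
      · exact (adj_up hn c r' h1 hr).symm
    by_cases hz : r = h0 ∧ ¬ ((c.val + r) % 2 = 0 ∧ 2 * m - c.val < c.val) ∧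
        ¬ ((c.val + r) % 2 = 1 ∧ c.val ≤ 2 * m - c.val)
    · refine vert (r + 1) (by omega) (Or.inl rfl) ?_
      rw [show (r + 1 - (h0 : ℕ)) + (h0 - (r + 1)) = 1 by omega,
        show (r - (h0 : ℕ)) + (h0 - r) = 0 by omega]
      exact bwD_dec_z hc (by omega) (by omega)
    by_cases hR : (c.val + r) % 2 = 0 ∧ 2 * m - c.val < c.val
    · refine ⟨(c + 1, ⟨r, hr⟩), adj_right hn c _ hR.1, ?_⟩
      simp only
      exact bwD_dec_r hc (by omega) hR.2 ((zmod_succ_iff hn c (c + 1)).1 rfl)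
    by_cases hL : (c.val + r) % 2 = 1 ∧ c.val ≤ 2 * m - c.val ∧ 0 < c.val
    · refine ⟨(c - 1, ⟨r, hr⟩), adj_left h2' hn c _ hL.1, ?_⟩
      have := (zmod_succ_iff hn (c - 1) c).1 (by ring)
      have e : c.val = (c - 1).val + 1 := by omega
      simp only
      generalize (c - 1).val = d at *
      rw [e]
      exact bwD_dec_l (by omega) (by omega) (by omega)
    rcases Nat.lt_or_ge r h0 with hlt' | hge
    · refine vert (r + 1) (by omega) (Or.inl rfl) ?_
      rw [show (r - (h0 : ℕ)) + (h0 - r) = ((r + 1 - h0) + (h0 - (r + 1))) + 1 by omega]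
      exact bwD_dec_y hc (by omega)
    · refine vert (r - 1) (by omega) (Or.inr (by omega)) ?_
      rw [show (r - (h0 : ℕ)) + (h0 - r) = ((r - 1 - h0) + (h0 - (r - 1))) + 1 by omega]
      exact bwD_dec_y hc (by omega)

theorem pair_sum (f : ℕ → ℕ) (j : ℕ) :
    ∑ t ∈ Finset.range (2 * j), f t = ∑ s ∈ Finset.range j, (f (2 * s) + f (2 * s + 1)) := by
  induction j with
  | zero => simp
  | succ j ih =>
    rw [show 2 * (j + 1) = 2 * j + 1 + 1 by ring, Finset.sum_range_succ, Finset.sum_range_succ,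
      ih, Finset.sum_range_succ]
    ring

theorem cyc_sum (g : ℕ → ℕ) (m : ℕ) (h : g 0 = g (4 * m)) :
    ∑ t ∈ Finset.range (4 * m), g t =
      ∑ s ∈ Finset.range m, ((g (2 * s + 1) + g (2 * s + 2)) +
        (g (4 * m - 2 * s) + g (4 * m - (2 * s + 1)))) := by
  have h1 : ∑ t ∈ Finset.range (4 * m), g t = ∑ t ∈ Finset.range (4 * m), g (t + 1) := by
    have e1 := Finset.sum_range_succ g (4 * m)
    have e2 := Finset.sum_range_succ' g (4 * m)
    omega
  have h2 : ∑ t ∈ Finset.range (2 * m), g (2 * m + t + 1) =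
      ∑ t ∈ Finset.range (2 * m), g (4 * m - t) := by
    rw [← Finset.sum_range_reflect]
    refine Finset.sum_congr rfl fun t ht => ?_
    rw [Finset.mem_range] at ht
    congr 1; omega
  rw [h1, show 4 * m = 2 * m + 2 * m by ring, Finset.sum_range_add, h2,
    pair_sum (fun t => g (t + 1)), pair_sum (fun t => g (4 * m - t)), ← Finset.sum_add_distrib,
    show 4 * m = 2 * m + 2 * m by ring]

theorem max_sum (p s : ℕ) (hs : s ≤ p) :
    ∑ k ∈ Finset.range (p + 1), max (2 * k + 1) (2 * s + 1) = (p + 1) ^ 2 + s * (s + 1) := by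
  induction p, hs using Nat.le_induction with
  | base =>
    have : ∀ k ∈ Finset.range (s + 1), max (2 * k + 1) (2 * s + 1) = 2 * s + 1 := by
      intro k hk
      rw [Finset.mem_range] at hk
      omega
    rw [Finset.sum_congr rfl this]
    simp; ring
  | succ p hp ih =>
    rw [Finset.sum_range_succ, ih, max_eq_left (by omega)]
    ring

theorem F_sum (m k : ℕ) :
    ∑ t ∈ Finset.range (4 * m), (bwD (4 * m) t 0 + bwD (4 * m) t (2 * k + 1)) =
      ∑ s ∈ Finset.range m, (24 * s + 12 + 4 * max (2 * k + 1) (2 * s + 1)) := by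
  rw [cyc_sum]
  · refine Finset.sum_congr rfl fun s hs => ?_
    rw [Finset.mem_range] at hs
    have a1 : bwD (4 * m) (2 * s + 1) 0 = 4 * s + 1 := by
      unfold bwD; split_ifs <;> omega
    have a2 : bwD (4 * m) (2 * s + 2) 0 = 4 * s + 4 := by
      unfold bwD; split_ifs <;> omega
    have a3 : bwD (4 * m) (4 * m - 2 * s) 0 = 4 * s := by
      unfold bwD; split_ifs <;> omega
    have a4 : bwD (4 * m) (4 * m - (2 * s + 1)) 0 = 4 * s + 3 := by
      unfold bwD; split_ifs <;> omega
    have b1 : bwD (4 * m) (2 * s + 1) (2 * k + 1) = 2 * s + 1 + max (2 * k + 1) (2 * s + 1) := by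
      unfold bwD; split_ifs <;> omega
    have b2 : bwD (4 * m) (2 * s + 2) (2 * k + 1) = 2 * s + 2 + max (2 * k + 1) (2 * s + 1) := by
      unfold bwD; split_ifs <;> omega
    have b3 : bwD (4 * m) (4 * m - 2 * s) (2 * k + 1) = 2 * s + max (2 * k + 1) (2 * s + 1) := by
      unfold bwD; split_ifs <;> omega
    have b4 : bwD (4 * m) (4 * m - (2 * s + 1)) (2 * k + 1) =
        2 * s + 1 + max (2 * k + 1) (2 * s + 1) := by
      unfold bwD; split_ifs <;> omega
    rw [a1, a2, a3, a4, b1, b2, b3, b4]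
    ring
  · unfold bwD; split_ifs <;> omega

theorem total_sum (m p : ℕ) (h : m ≤ p) :
    3 * (∑ k ∈ Finset.range (p + 1),
      ∑ t ∈ Finset.range (4 * m), (bwD (4 * m) t 0 + bwD (4 * m) t (2 * k + 1))) + 4 * m =
      36 * (p + 1) * m ^ 2 + 12 * m * (p + 1) ^ 2 + 4 * m ^ 3 := by
  simp only [F_sum]
  rw [Finset.sum_comm]
  have e : ∀ s ∈ Finset.range m, ∑ k ∈ Finset.range (p + 1),
      (24 * s + 12 + 4 * max (2 * k + 1) (2 * s + 1)) =
      (p + 1) * (24 * s + 12) + 4 * ((p + 1) ^ 2 + s * (s + 1)) := by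
    intro s hs
    rw [Finset.mem_range] at hs
    rw [Finset.sum_add_distrib, ← Finset.mul_sum, max_sum p s (by omega)]
    simp
  rw [Finset.sum_congr rfl e]
  clear e h
  induction m with
  | zero => simp
  | succ m ih =>
    rw [Finset.sum_range_succ]
    nlinarith [ih]

theorem refl_sum (F : ℕ → ℕ) (p : ℕ) :
    ∑ h ∈ Finset.range (2 * p + 2), F ((2 * p + 1 - 2 * h) + (2 * h - (2 * p + 1))) =
      2 * ∑ k ∈ Finset.range (p + 1), F (2 * k + 1) := by
  have e1 : ∑ h ∈ Finset.range (p + 1), F ((2 * p + 1 - 2 * h) + (2 * h - (2 * p + 1))) =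
      ∑ k ∈ Finset.range (p + 1), F (2 * k + 1) := by
    rw [← Finset.sum_range_reflect (fun k => F (2 * k + 1)) (p + 1)]
    refine Finset.sum_congr rfl fun t ht => ?_
    rw [Finset.mem_range] at ht
    congr 1; omega
  have e2 : ∑ t ∈ Finset.range (p + 1),
      F ((2 * p + 1 - 2 * (p + 1 + t)) + (2 * (p + 1 + t) - (2 * p + 1))) =
      ∑ k ∈ Finset.range (p + 1), F (2 * k + 1) := by
    refine Finset.sum_congr rfl fun t ht => ?_
    congr 1; omega
  rw [show Finset.range (2 * p + 2) = Finset.range ((p + 1) + (p + 1)) by congr 1; ring,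
    Finset.sum_range_add, e1, e2, two_mul]

theorem zmod_sum (n : ℕ) [NeZero n] (g : ℕ → ℕ) :
    ∑ s : ZMod n, g s.val = ∑ t ∈ Finset.range n, g t := by
  obtain ⟨k, rfl⟩ : ∃ k, n = k + 1 := ⟨n - 1, by have := NeZero.pos n; omega⟩
  exact Fin.sum_univ_eq_sum_range g (k + 1)

/-- The inner sum. -/
noncomputable def TT {V : Type*} (G : SimpleGraph V) (u : V) : ℚ :=
  ∑ᶠ α : G ≃g G, (G.dist u (α u) : ℚ)

theorem TT_map {V : Type*} {G : SimpleGraph V} (e : G ≃g G) (u : V) :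
    TT G (e u) = TT G u := by
  let E : (G ≃g G) ≃ (G ≃g G) :=
    { toFun := fun a => (e.symm.trans a).trans e
      invFun := fun a => (e.trans a).trans e.symm
      left_inv := fun a => by ext; simp
      right_inv := fun a => by ext; simp }
  symm
  refine finsum_eq_of_bijective E E.bijective fun a => ?_
  have : (E a) (e u) = e (a u) := by simp [E]
  rw [this, iso_dist]

/-- Orbit sum. -/
def FF (n y : ℕ) : ℕ := ∑ t ∈ Finset.range n, (bwD n t 0 + bwD n t y)

theorem TT_even {n p : ℕ} (h2 : 2 ∣ n) (hn : 2 ≤ n) (hp : 2 ≤ p) (h : Fin (2 * p + 2))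
    (he : (h : ℕ) % 2 = 0) :
    TT (BW n p) (0, h) = FF n ((2 * p + 1 - 2 * h) + (2 * h - (2 * p + 1))) := by
  have hne : NeZero n := ⟨by omega⟩
  have hlt := h.isLt
  have e1 : TT (BW n p) (0, h) = ∑ᶠ x : ZMod n × Bool,
      ((BW n p).dist (0, h) (x.1, if x.2 then Fin.rev h else h) : ℚ) := by
    symm
    refine finsum_eq_of_bijective _ (bwAut_bij h2 hn hp) fun x => ?_
    rw [bwAut_apply, bwMap_zero]
  rw [e1, finsum_eq_sum_of_fintype, Fintype.sum_prod_type]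
  simp only [Fintype.sum_bool, if_true, bw_dist h2 hn h he, Fin.val_rev]
  unfold FF
  rw [← zmod_sum n]
  push_cast
  refine Finset.sum_congr rfl fun s _ => ?_
  rw [add_comm]
  congr 3
  · simp
  · omega

theorem TT_col {n p : ℕ} (h2 : 2 ∣ n) (hn : 2 ≤ n) (c : ZMod n) (h : Fin (2 * p + 2)) :
    TT (BW n p) (c, h) = TT (BW n p) (0, h) := by
  have := TT_map (bwAut (p := p) h2 hn (c, false)) (0, h)
  rw [bwAut_apply, bwMap_zero] at this
  exact this

theorem TT_all {n p : ℕ} (h2 : 2 ∣ n) (hn : 2 ≤ n) (hp : 2 ≤ p) (c : ZMod n)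
    (h : Fin (2 * p + 2)) :
    TT (BW n p) (c, h) = FF n ((2 * p + 1 - 2 * h) + (2 * h - (2 * p + 1))) := by
  rw [TT_col h2 hn]
  rcases Nat.mod_two_eq_zero_or_one (h : ℕ) with he | he
  · exact TT_even h2 hn hp h he
  · have := TT_map (bwAut (p := p) h2 hn (0, true)) (0, h)
    rw [bwAut_apply, bwMap_zero] at this
    have hlt := h.isLt
    rw [← this]
    simp only [if_true]
    rw [TT_even h2 hn hp _ (by rw [Fin.val_rev]; omega), Fin.val_rev]
    congr 2
    omega

theorem GP_BW {n p : ℕ} (h2 : 2 ∣ n) (hn : 2 ≤ n) (hp : 2 ≤ p) :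
    GPindex (BW n p) = (p + 1) * n * (∑ k ∈ Finset.range (p + 1), FF n (2 * k + 1) : ℕ) := by
  have hne : NeZero n := ⟨by omega⟩
  have hc : Nat.card (BW n p ≃g BW n p) = 2 * n := by
    rw [← Nat.card_congr (Equiv.ofBijective _ (bwAut_bij h2 hn hp))]
    simp [mul_comm]
  have hv : Nat.card (ZMod n × Fin (2 * p + 2)) = n * (2 * p + 2) := by
    simp
  have hs : ∑ᶠ u : ZMod n × Fin (2 * p + 2), TT (BW n p) u =
      2 * n * (∑ k ∈ Finset.range (p + 1), FF n (2 * k + 1) : ℕ) := by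
    rw [finsum_eq_sum_of_fintype, Fintype.sum_prod_type]
    simp only [TT_all h2 hn hp]
    rw [Finset.sum_const, Finset.card_univ, ZMod.card, nsmul_eq_mul,
      ← Nat.cast_sum, Fin.sum_univ_eq_sum_range
        (fun h => FF n ((2 * p + 1 - 2 * h) + (2 * h - (2 * p + 1)))), refl_sum]
    push_cast; ring
  have : GPindex (BW n p) = ((Nat.card (ZMod n × Fin (2 * p + 2)) : ℚ) /
      (2 * (Nat.card (BW n p ≃g BW n p) : ℚ))) * ∑ᶠ u, TT (BW n p) u := rfl
  rw [this, hs, hc, hv]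
  have : (n : ℚ) ≠ 0 := by exact_mod_cast (by omega : n ≠ 0)
  push_cast
  field_simp

theorem stmt16 (n p : ℕ) (hp : 4 ≤ p) (hpe : Even p) (hn4 : 4 ∣ n) (hn : 16 ≤ n)
    (hle : n ≤ 4 * p) :
    GPindex (AT n p) =
      ((p : ℚ) + 1) * ((n : ℚ) ^ 4 / 48 + 3 * (n : ℚ) ^ 3 * (p : ℚ) / 4 +
        3 * (n : ℚ) ^ 3 / 4 + (n : ℚ) ^ 2 * (p : ℚ) ^ 2 + 2 * (n : ℚ) ^ 2 * (p : ℚ) +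
        2 * (n : ℚ) ^ 2 / 3) := by

  obtain ⟨m, rfl⟩ := hn4
  rw [GPindex_iso (isoBW (by omega) ⟨m, rfl⟩), GP_BW (by omega) (by omega) (by omega)]
  have h := total_sum m p (by omega)
  have h' : (3 : ℚ) * ((∑ k ∈ Finset.range (p + 1), FF (4 * m) (2 * k + 1) : ℕ) : ℚ) + 4 * m =
      36 * (p + 1) * m ^ 2 + 12 * m * (p + 1) ^ 2 + 4 * m ^ 3 := by
    unfold FF
    exact_mod_cast h
  generalize ((∑ k ∈ Finset.range (p + 1), FF (4 * m) (2 * k + 1) : ℕ) : ℚ) = X at *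
  have hX : X = 12 * (p + 1) * m ^ 2 + 4 * m * (p + 1) ^ 2 + 4 / 3 * m ^ 3 - 4 / 3 * m := by
    linarith
  rw [hX]
  push_cast
  ring
end
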